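/- arXiv:1212.4120 — 2 statements merged into one kernel-verified Lean document; each statement's English description precedes it below -/
import Mathlib

section
/- Let K be a field of characteristic 0, S = K[x_1, …, x_n] a positively graded polynomial ring with deg x_i = a_i > 0, I ⊂ S a proper graded ideal, and k ≥ 2 an integer. Then the Koszul homology H(x; S/I^k) of R = S/I^k with respect to x = x_1,…,x_n has trivial multiplication: for all i, j ≥ 1 and all homology classes h_1 ∈ H_i(x; R), h_2 ∈ H_j(x; R), the product h_1 · h_2 = 0 in H_{i+j}(x; R). -/
set_option synthInstance.maxHeartbeats 1000000
set_option maxHeartbeats 1000000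

/-- The Koszul differential on the Koszul complex `K(R) = ⋀(⊕_{i=1}^n R e_i)` of `R`
with respect to the sequence `x = x_1, …, x_n`, i.e. the contraction (interior product)
of the exterior algebra by the dual vector `e_i ↦ x_i`; it satisfies `∂(e_i) = x_i`. -/
noncomputable def koszulDiff (R : Type) [CommRing R] {n : ℕ} (x : Fin n → R) :
    ExteriorAlgebra R (Fin n → R) →ₗ[R] ExteriorAlgebra R (Fin n → R) :=
  CliffordAlgebra.contractLeft (∑ i, x i • LinearMap.proj i)

/-- The `R`-module `Z_l(R)` of Koszul cycles in homological degree `l`: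
elements of `K_l(R) = ⋀^l(⊕ R e_i)` killed by the Koszul differential. -/
noncomputable def koszulCycles (R : Type) [CommRing R] {n : ℕ} (x : Fin n → R) (l : ℕ) :
    Submodule R (ExteriorAlgebra R (Fin n → R)) :=
  ⋀[R]^l (Fin n → R) ⊓ LinearMap.ker (koszulDiff R x)

/-- The `R`-module `B_l(R)` of Koszul boundaries in homological degree `l`:
images under the Koszul differential of elements of `K_{l+1}(R)`. -/
noncomputable def koszulBoundaries (R : Type) [CommRing R] {n : ℕ} (x : Fin n → R) (l : ℕ) :
    Submodule R (ExteriorAlgebra R (Fin n → R)) :=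
  Submodule.map (koszulDiff R x) (⋀[R]^(l + 1) (Fin n → R))

open scoped TensorProduct Pointwise

namespace ExteriorAlgebra

section Contraction

variable {R M : Type*} [CommRing R] [AddCommGroup M] [Module R M]

theorem contractLeft_mem_exteriorPower (φ : Module.Dual R M) {l : ℕ} {x : ExteriorAlgebra R M}
    (hx : x ∈ ⋀[R]^(l + 1) M) : CliffordAlgebra.contractLeft φ x ∈ ⋀[R]^l M := by
  induction l generalizing x with
  | zero =>
    rw [exteriorPower, zero_add, pow_one] at hx
    obtain ⟨v, rfl⟩ := hx
    rw [exteriorPower, pow_zero]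
    exact (CliffordAlgebra.contractLeft_ι (Q := (0 : QuadraticForm R M)) (d := φ) v).symm ▸
      Submodule.algebraMap_mem _
  | succ l ih =>
    rw [exteriorPower, pow_succ'] at hx
    induction hx using Submodule.mul_induction_on' with
    | mem_mul_mem m hm y hy =>
      obtain ⟨v, rfl⟩ := hm
      erw [CliffordAlgebra.contractLeft_ι_mul]
      refine sub_mem (Submodule.smul_mem _ _ hy) ?_
      rw [exteriorPower, pow_succ']
      exact Submodule.mul_mem_mul ⟨v, rfl⟩ (ih hy)
    | add y _ z _ hy hz => rw [map_add]; exact add_mem hy hz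

theorem contractLeft_mul_of_mem_exteriorPower (φ : Module.Dual R M) {l : ℕ}
    {x : ExteriorAlgebra R M} (hx : x ∈ ⋀[R]^l M) (y : ExteriorAlgebra R M) :
    CliffordAlgebra.contractLeft φ (x * y) =
      CliffordAlgebra.contractLeft φ x * y + (-1) ^ l * (x * CliffordAlgebra.contractLeft φ y) := by
  induction hx using Submodule.pow_induction_on_left' with
  | algebraMap r =>
    erw [CliffordAlgebra.contractLeft_algebraMap_mul, CliffordAlgebra.contractLeft_algebraMap]
    simp
  | add x z l hx hz ihx ihz => rw [add_mul, map_add, map_add, ihx, ihz]; noncomm_ring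
  | mem_mul m hm l x hx ih =>
    obtain ⟨v, rfl⟩ := hm
    rw [mul_assoc]
    erw [CliffordAlgebra.contractLeft_ι_mul, CliffordAlgebra.contractLeft_ι_mul]
    rw [ih, sub_mul, smul_mul_assoc, mul_add]
    have h : (-1 : ExteriorAlgebra R M) ^ l * ι R v = ι R v * (-1) ^ l :=
      ((Commute.neg_one_left _).pow_left l).eq
    rw [← mul_assoc (CliffordAlgebra.ι (0 : QuadraticForm R M) v) ((-1) ^ l)]
    erw [← h]
    rw [pow_succ]
    noncomm_ring

end Contraction

section WeightOperator

variable (K : Type*) [Field K] {n : ℕ} (a : Fin n → ℕ)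

/-- The generator `e_s` of the exterior algebra of `K ^ n`. -/
noncomputable def gen (s : Fin n) : ExteriorAlgebra K (Fin n → K) :=
  ι K (Pi.single s 1)

/-- Contraction with the `s`-th coordinate function. -/
noncomputable def coordContract (s : Fin n) :
    ExteriorAlgebra K (Fin n → K) →ₗ[K] ExteriorAlgebra K (Fin n → K) :=
  CliffordAlgebra.contractLeft (LinearMap.proj s)

variable {K}

theorem coordContract_gen_mul (s t : Fin n) (x : ExteriorAlgebra K (Fin n → K)) :
    coordContract K s (gen K t * x) =
      (Pi.single t 1 : Fin n → K) s • x - gen K t * coordContract K s x :=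
  CliffordAlgebra.contractLeft_ι_mul (Q := (0 : QuadraticForm K (Fin n → K))) _ _ _

theorem coordContract_comm (s t : Fin n) (x : ExteriorAlgebra K (Fin n → K)) :
    coordContract K s (coordContract K t x) = -coordContract K t (coordContract K s x) :=
  CliffordAlgebra.contractLeft_comm (Q := (0 : QuadraticForm K (Fin n → K))) _ _ _

theorem gen_mul_gen_comm (s t : Fin n) : gen K s * gen K t = -(gen K t * gen K s) :=
  eq_neg_of_add_eq_zero_left (ι_add_mul_swap _ _)

theorem ι_eq_sum_gen (v : Fin n → K) : ι K v = ∑ s, v s • gen K s := by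
  conv_lhs => rw [pi_eq_sum_univ' v]
  simp only [map_sum, map_smul]
  rfl

theorem exteriorPower_eq_span_gen (l : ℕ) :
    ⋀[K]^l (Fin n → K) = Submodule.span K (Set.range (gen K (n := n)) ^ l) := by
  rw [← Submodule.span_pow, exteriorPower]
  congr 1
  refine le_antisymm ?_ (Submodule.span_le.2 ?_)
  · rintro _ ⟨v, rfl⟩
    rw [ι_eq_sum_gen]
    exact sum_mem fun s _ => Submodule.smul_mem _ _ (Submodule.subset_span ⟨s, rfl⟩)
  · rintro _ ⟨s, rfl⟩
    exact ⟨_, rfl⟩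

/-- The operator multiplying `e_{s₁} ∧ ⋯ ∧ e_{s_l}` by its weight `a s₁ + ⋯ + a s_l`. -/
noncomputable def weightOp : ExteriorAlgebra K (Fin n → K) →ₗ[K] ExteriorAlgebra K (Fin n → K) :=
  ∑ s, (a s : K) • LinearMap.mulLeft K (gen K s) ∘ₗ coordContract K s

theorem weightOp_apply (x : ExteriorAlgebra K (Fin n → K)) :
    weightOp a x = ∑ s, (a s : K) • (gen K s * coordContract K s x) := by
  simp [weightOp]

theorem weightOp_gen_mul (t : Fin n) (x : ExteriorAlgebra K (Fin n → K)) :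
    weightOp a (gen K t * x) = (a t : K) • (gen K t * x) + gen K t * weightOp a x := by
  have h (s : Fin n) : gen K s * (gen K t * coordContract K s x) =
      -(gen K t * (gen K s * coordContract K s x)) := by
    rw [← mul_assoc, gen_mul_gen_comm, neg_mul, mul_assoc]
  simp only [weightOp_apply, coordContract_gen_mul, mul_sub, h, sub_neg_eq_add, smul_add,
    Finset.sum_add_distrib, Finset.mul_sum, mul_smul_comm]
  congr 1
  rw [Finset.sum_eq_single t] <;> simp +contextual

theorem exists_weightOp_eq_smul (ha : ∀ s, 0 < a s) {l : ℕ} {x : ExteriorAlgebra K (Fin n → K)}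
    (hx : x ∈ Set.range (gen K (n := n)) ^ l) :
    ∃ w : ℕ, l ≤ w ∧ weightOp a x = (w : K) • x := by
  induction l generalizing x with
  | zero =>
    rw [pow_zero, Set.mem_one] at hx
    subst hx
    refine ⟨0, le_rfl, ?_⟩
    simp only [weightOp_apply, Nat.cast_zero, zero_smul]
    refine Finset.sum_eq_zero fun s _ => ?_
    rw [coordContract]
    erw [CliffordAlgebra.contractLeft_one]
    simp
  | succ l ih =>
    rw [pow_succ', Set.mem_mul] at hx
    obtain ⟨_, ⟨t, rfl⟩, y, hy, rfl⟩ := hx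
    obtain ⟨w, hw, h⟩ := ih hy
    refine ⟨a t + w, by have := ha t; omega, ?_⟩
    rw [weightOp_gen_mul, h, mul_smul_comm, Nat.cast_add, add_smul]

end WeightOperator

end ExteriorAlgebra

section AnnihilatedByPolynomial

open Polynomial in
/-- The elements killed by a polynomial in `L` with nonzero constant term. -/
def Module.End.polyTorsion {K V : Type*} [Field K] [AddCommGroup V] [Module K V]
    (L : Module.End K V) : Submodule K V where
  carrier := {v | ∃ q : K[X], q.coeff 0 ≠ 0 ∧ aeval L q v = 0}
  zero_mem' := ⟨1, by simp, by simp⟩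
  add_mem' := by
    rintro v w ⟨p, hp, hv⟩ ⟨q, hq, hw⟩
    refine ⟨p * q, by simp [mul_coeff_zero, hp, hq], ?_⟩
    have h : aeval L (p * q) v = 0 := by
      rw [mul_comm, map_mul, Module.End.mul_apply, hv, map_zero]
    rw [map_add, h, map_mul, Module.End.mul_apply, hw, map_zero, add_zero]
  smul_mem' := by
    rintro c v ⟨p, hp, hv⟩
    exact ⟨p, hp, by rw [map_smul, hv, smul_zero]⟩

variable {K V : Type*} [Field K] [AddCommGroup V] [Module K V] {L : Module.End K V}

open Polynomial in
theorem Module.End.mem_polyTorsion_of_eq_smul {v : V} {c : K} (hc : c ≠ 0) (h : L v = c • v) :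
    v ∈ L.polyTorsion :=
  ⟨X - C c, by simpa using hc, by simp [h]⟩

open Polynomial in
theorem Module.End.exists_apply_eq_of_mem_polyTorsion {P : Submodule K V}
    (hP : ∀ v ∈ P, L v ∈ P) {v : V} (hv : v ∈ P) (h : v ∈ L.polyTorsion) :
    ∃ w ∈ P, L w = v := by
  obtain ⟨q, hq, hqv⟩ := h
  have haeval (g : K[X]) : aeval L g v ∈ P := by
    induction g using Polynomial.induction_on' with
    | add p q hp hq => rw [map_add]; exact add_mem hp hq
    | monomial m c =>
      rw [aeval_monomial, Module.End.mul_apply, Module.algebraMap_end_apply]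
      refine P.smul_mem _ ?_
      induction m with
      | zero => simpa using hv
      | succ m ih => rw [pow_succ', Module.End.mul_apply]; exact hP _ ih
  refine ⟨-(q.coeff 0)⁻¹ • aeval L q.divX v, P.smul_mem _ (haeval _), ?_⟩
  have hq' : L (aeval L q.divX v) + q.coeff 0 • v = 0 := by
    have h : aeval L (X * q.divX + C (q.coeff 0)) v = 0 := by rw [X_mul_divX_add, hqv]
    rwa [map_add, map_mul, aeval_X, aeval_C, LinearMap.add_apply, Module.End.mul_apply,
      Module.algebraMap_end_apply] at h
  rw [map_smul, eq_neg_of_add_eq_zero_left hq', neg_smul, smul_neg, neg_neg, smul_smul,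
    inv_mul_cancel₀ hq, one_smul]

end AnnihilatedByPolynomial

namespace MvPolynomial

variable {K : Type*} [Field K] {n : ℕ} (a : Fin n → ℕ)

/-- The weighted Euler derivation `f ↦ ∑ a_s x_s ∂f/∂x_s`. -/
noncomputable def eulerDerivation :
    Derivation K (MvPolynomial (Fin n) K) (MvPolynomial (Fin n) K) :=
  ∑ s, ((a s : K) • (X s : MvPolynomial (Fin n) K) • pderiv s)

theorem eulerDerivation_apply (f : MvPolynomial (Fin n) K) :
    eulerDerivation a f = ∑ s, (a s : K) • (X s * pderiv s f) := by
  rw [eulerDerivation, ← Derivation.coeFnAddMonoidHom_apply, map_sum, Finset.sum_apply]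
  simp

variable {a} in
theorem IsWeightedHomogeneous.eulerDerivation_eq {f : MvPolynomial (Fin n) K} {d : ℕ}
    (hf : f.IsWeightedHomogeneous a d) : eulerDerivation a f = (d : K) • f := by
  rw [eulerDerivation_apply, Nat.cast_smul_eq_nsmul, ← hf.sum_weight_X_mul_pderiv]
  simp only [Nat.cast_smul_eq_nsmul]

theorem eulerDerivation_mem {I : Ideal (MvPolynomial (Fin n) K)}
    (hI : ∀ f ∈ I, ∀ d : ℕ, weightedHomogeneousComponent a d f ∈ I)
    {f : MvPolynomial (Fin n) K} (hf : f ∈ I) : eulerDerivation a f ∈ I := by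
  rw [← sum_weightedHomogeneousComponent a f,
    finsum_eq_sum _ (weightedHomogeneousComponent_finsupp f), map_sum]
  refine sum_mem fun d _ => ?_
  rw [(weightedHomogeneousComponent_isWeightedHomogeneous d f).eulerDerivation_eq, smul_eq_C_mul]
  exact I.mul_mem_left _ (hI f hf d)

end MvPolynomial

theorem Derivation.apply_mem_pow {R A : Type*} [CommRing R] [CommRing A] [Algebra R A]
    (D : Derivation R A A) {I : Ideal A} (hD : ∀ f ∈ I, D f ∈ I) (k : ℕ) {f : A}
    (hf : f ∈ I ^ k) : D f ∈ I ^ k := by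
  induction k generalizing f with
  | zero => simp
  | succ k ih =>
    rw [pow_succ] at hf ⊢
    induction hf using Submodule.mul_induction_on' with
    | mem_mul_mem x hx y hy =>
      rw [D.leibniz, smul_eq_mul, smul_eq_mul, mul_comm y]
      exact add_mem (Ideal.mul_mem_mul hx (hD _ hy)) (Ideal.mul_mem_mul (ih hx) hy)
    | add x _ y _ hx hy => rw [map_add]; exact add_mem hx hy

theorem Derivation.apply_mem_pow_of_mem_pow_succ {R A : Type*} [CommRing R] [CommRing A]
    [Algebra R A] (D : Derivation R A A) {I : Ideal A} (k : ℕ) {f : A}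
    (hf : f ∈ I ^ (k + 1)) : D f ∈ I ^ k := by
  induction k generalizing f with
  | zero => simp
  | succ k ih =>
    rw [pow_succ] at hf
    induction hf using Submodule.mul_induction_on' with
    | mem_mul_mem x hx y hy =>
      rw [D.leibniz, smul_eq_mul, smul_eq_mul]
      refine add_mem (Ideal.mul_mem_right _ _ hx) ?_
      rw [pow_succ, mul_comm y]
      exact Ideal.mul_mem_mul (ih hx) hy
    | add x _ y _ hx hy => rw [map_add]; exact add_mem hx hy

theorem eq_zero_of_eq_neg (K : Type*) {V : Type*} [Field K] [CharZero K] [AddCommGroup V]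
    [Module K V] {v : V} (h : v = -v) : v = 0 := by
  have h2 : (2 : K) • v = 0 := by rw [two_smul]; exact add_eq_zero_iff_eq_neg.2 h
  exact (smul_eq_zero.1 h2).resolve_left two_ne_zero

namespace MvPolynomial

open ExteriorAlgebra TensorProduct

section Forms

variable (K : Type*) [Field K] {n : ℕ} (a : Fin n → ℕ)

variable (n) in
/-- The algebra of polynomial differential forms in `n` variables. -/
abbrev Forms : Type _ := MvPolynomial (Fin n) K ⊗[K] ExteriorAlgebra K (Fin n → K)

/-- The Koszul differential on polynomial differential forms. -/
noncomputable def formDel : Forms K n →ₗ[K] Forms K n :=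
  ∑ s, TensorProduct.map (LinearMap.mulLeft K (X s)) (coordContract K s)

/-- The de Rham differential, rescaled so that it sends `x_s` to `a s • e_s`. -/
noncomputable def formD : Forms K n →ₗ[K] Forms K n :=
  ∑ s, (a s : K) • TensorProduct.map (pderiv s).toLinearMap (LinearMap.mulLeft K (gen K s))

variable {K}

theorem formDel_tmul (f : MvPolynomial (Fin n) K) (x : ExteriorAlgebra K (Fin n → K)) :
    formDel K (f ⊗ₜ x) = ∑ s, (X s * f) ⊗ₜ coordContract K s x := by
  simp [formDel]

theorem formD_tmul (f : MvPolynomial (Fin n) K) (x : ExteriorAlgebra K (Fin n → K)) :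
    formD K a (f ⊗ₜ x) = ∑ s, (a s : K) • pderiv s f ⊗ₜ (gen K s * x) := by
  simp [formD]

theorem formDel_formDel [CharZero K] (z : Forms K n) : formDel K (formDel K z) = 0 := by
  induction z using TensorProduct.induction_on with
  | zero => simp
  | add y z hy hz => rw [map_add, map_add, hy, hz, add_zero]
  | tmul f x =>
    refine eq_zero_of_eq_neg K ?_
    simp only [formDel_tmul, map_sum, ← Finset.sum_neg_distrib]
    rw [Finset.sum_comm]
    refine Finset.sum_congr rfl fun s _ => Finset.sum_congr rfl fun t _ => ?_
    rw [coordContract_comm, tmul_neg, mul_left_comm]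

variable (K) in
/-- The Laplacian `d ∂ + ∂ d`. -/
noncomputable def formLap : Module.End K (Forms K n) :=
  formD K a ∘ₗ formDel K + formDel K ∘ₗ formD K a

theorem formLap_apply (z : Forms K n) :
    formLap K a z = formD K a (formDel K z) + formDel K (formD K a z) := rfl

theorem formLap_tmul (f : MvPolynomial (Fin n) K) (x : ExteriorAlgebra K (Fin n → K)) :
    formLap K a (f ⊗ₜ x) = eulerDerivation a f ⊗ₜ x + f ⊗ₜ weightOp a x := by
  have h (s t : Fin n) :
      (a t : K) • pderiv t (X s * f) ⊗ₜ[K] (gen K t * coordContract K s x) +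
        (a t : K) • (X s * pderiv t f) ⊗ₜ[K] coordContract K s (gen K t * x) =
      if s = t then (a s : K) • (X s * pderiv s f) ⊗ₜ[K] x +
        (a s : K) • f ⊗ₜ[K] (gen K s * coordContract K s x) else 0 := by
    rw [coordContract_gen_mul, Derivation.leibniz, pderiv_X]
    split_ifs with hst
    · subst hst
      simp [add_tmul, tmul_sub, smul_sub, smul_add]
      abel
    · simp [hst, tmul_neg]
  rw [formLap_apply, formDel_tmul, formD_tmul, map_sum, map_sum]
  simp only [map_smul, formD_tmul, formDel_tmul, Finset.smul_sum]
  conv_lhs => arg 2; rw [Finset.sum_comm]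
  rw [← Finset.sum_add_distrib]
  simp only [← Finset.sum_add_distrib, h]
  simp [eulerDerivation_apply, weightOp_apply, sum_tmul, tmul_sum, Finset.sum_add_distrib,
    smul_tmul']

/-- Forms with coefficients in the ideal `J`. -/
noncomputable def formsWithCoeff (J : Ideal (MvPolynomial (Fin n) K)) : Submodule K (Forms K n) :=
  Submodule.map₂ (TensorProduct.mk K _ _) (J.restrictScalars K) ⊤

variable (K n) in
/-- Forms of degree `l`. -/
noncomputable def formsOfDegree (l : ℕ) : Submodule K (Forms K n) :=
  Submodule.map₂ (TensorProduct.mk K _ _) ⊤ (⋀[K]^l (Fin n → K))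

theorem tmul_mem_formsWithCoeff {J : Ideal (MvPolynomial (Fin n) K)} {f : MvPolynomial (Fin n) K}
    (hf : f ∈ J) (x : ExteriorAlgebra K (Fin n → K)) : f ⊗ₜ x ∈ formsWithCoeff J :=
  Submodule.apply_mem_map₂ _ hf trivial

theorem tmul_mem_formsOfDegree {l : ℕ} (f : MvPolynomial (Fin n) K)
    {x : ExteriorAlgebra K (Fin n → K)} (hx : x ∈ ⋀[K]^l (Fin n → K)) :
    f ⊗ₜ x ∈ formsOfDegree K n l :=
  Submodule.apply_mem_map₂ _ trivial hx

theorem formDel_mem_formsOfDegree {l : ℕ} {z : Forms K n} (hz : z ∈ formsOfDegree K n (l + 1)) :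
    formDel K z ∈ formsOfDegree K n l := by
  suffices h : formsOfDegree K n (l + 1) ≤ (formsOfDegree K n l).comap (formDel K) from h hz
  refine Submodule.map₂_le.2 fun f _ x hx => ?_
  rw [Submodule.mem_comap, mk_apply, formDel_tmul]
  exact sum_mem fun s _ => tmul_mem_formsOfDegree _ (contractLeft_mem_exteriorPower _ hx)

theorem formD_mem_formsOfDegree {l : ℕ} {z : Forms K n} (hz : z ∈ formsOfDegree K n l) :
    formD K a z ∈ formsOfDegree K n (l + 1) := by
  suffices h : formsOfDegree K n l ≤ (formsOfDegree K n (l + 1)).comap (formD K a) from h hz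
  refine Submodule.map₂_le.2 fun f _ x hx => ?_
  rw [Submodule.mem_comap, mk_apply, formD_tmul]
  refine sum_mem fun s _ => Submodule.smul_mem _ _ (tmul_mem_formsOfDegree _ ?_)
  rw [exteriorPower, pow_succ']
  exact Submodule.mul_mem_mul ⟨_, rfl⟩ hx

theorem formLap_mem_formsWithCoeff {J : Ideal (MvPolynomial (Fin n) K)}
    (hJ : ∀ f ∈ J, eulerDerivation a f ∈ J) {z : Forms K n} (hz : z ∈ formsWithCoeff J) :
    formLap K a z ∈ formsWithCoeff J := by
  suffices h : formsWithCoeff J ≤ (formsWithCoeff J).comap (formLap K a) from h hz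
  refine Submodule.map₂_le.2 fun f hf x _ => ?_
  rw [Submodule.mem_comap, mk_apply, formLap_tmul]
  exact add_mem (tmul_mem_formsWithCoeff (hJ f hf) _) (tmul_mem_formsWithCoeff hf _)

theorem formD_mem_formsWithCoeff {J J' : Ideal (MvPolynomial (Fin n) K)}
    (hJ : ∀ f ∈ J, ∀ s, pderiv s f ∈ J') {z : Forms K n} (hz : z ∈ formsWithCoeff J) :
    formD K a z ∈ formsWithCoeff J' := by
  suffices h : formsWithCoeff J ≤ (formsWithCoeff J').comap (formD K a) from h hz
  refine Submodule.map₂_le.2 fun f hf x _ => ?_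
  rw [Submodule.mem_comap, mk_apply, formD_tmul]
  exact sum_mem fun s _ => Submodule.smul_mem _ _ (tmul_mem_formsWithCoeff (hJ f hf s) _)

theorem mul_mem_formsWithCoeff {J J' : Ideal (MvPolynomial (Fin n) K)} {y z : Forms K n}
    (hy : y ∈ formsWithCoeff J) (hz : z ∈ formsWithCoeff J') :
    y * z ∈ formsWithCoeff (J * J') := by
  suffices h : formsWithCoeff J ≤ (formsWithCoeff (J * J')).comap (LinearMap.mulRight K z) from
    h hy
  refine Submodule.map₂_le.2 fun f hf x _ => ?_
  rw [Submodule.mem_comap, mk_apply, LinearMap.mulRight_apply]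
  suffices h : formsWithCoeff J' ≤
      (formsWithCoeff (J * J')).comap (LinearMap.mulLeft K (f ⊗ₜ[K] x)) from h hz
  refine Submodule.map₂_le.2 fun g hg y _ => ?_
  rw [Submodule.mem_comap, mk_apply, LinearMap.mulLeft_apply, Algebra.TensorProduct.tmul_mul_tmul]
  exact tmul_mem_formsWithCoeff (Ideal.mul_mem_mul hf hg) _

variable [CharZero K]

theorem formsOfDegree_le_polyTorsion (ha : ∀ s, 0 < a s) {l : ℕ} (hl : 1 ≤ l) :
    formsOfDegree K n l ≤ (formLap K a).polyTorsion := by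
  refine Submodule.map₂_le.2 fun f _ x hx => ?_
  rw [mk_apply]
  induction f using MvPolynomial.induction_on' with
  | add p q hp hq => rw [add_tmul]; exact add_mem (hp trivial) (hq trivial)
  | monomial u c =>
    rw [exteriorPower_eq_span_gen] at hx
    induction hx using Submodule.span_induction with
    | zero => rw [tmul_zero]; exact zero_mem _
    | add y z _ _ hy hz => rw [tmul_add]; exact add_mem hy hz
    | smul r y _ hy => rw [tmul_smul]; exact Submodule.smul_mem _ _ hy
    | mem y hy =>
      obtain ⟨w, hw, h⟩ := exists_weightOp_eq_smul a ha hy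
      refine Module.End.mem_polyTorsion_of_eq_smul
        (c := ((Finsupp.weight a u + w : ℕ) : K)) (Nat.cast_ne_zero.2 (by omega)) ?_
      rw [formLap_tmul, h, (isWeightedHomogeneous_monomial a u c rfl).eulerDerivation_eq,
        tmul_smul, ← smul_tmul', Nat.cast_add, add_smul]

/-- A form of positive degree which is a Koszul cycle modulo a graded ideal `J` is, modulo Koszul
boundaries, the de Rham differential of a form with coefficients in `J`. -/
theorem exists_eq_formD_add_formDel (ha : ∀ s, 0 < a s) {J : Ideal (MvPolynomial (Fin n) K)}
    (hJ : ∀ f ∈ J, eulerDerivation a f ∈ J) {l : ℕ} (hl : 1 ≤ l) {z : Forms K n}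
    (hz : z ∈ formsOfDegree K n l) (hdz : formDel K z ∈ formsWithCoeff J) :
    ∃ y ∈ formsWithCoeff J, ∃ u ∈ formsOfDegree K n (l + 1), z = formD K a y + formDel K u := by
  have hP (v : Forms K n) (hv : v ∈ formsOfDegree K n l ⊓ (formsWithCoeff J).comap (formDel K)) :
      formLap K a v ∈ formsOfDegree K n l ⊓ (formsWithCoeff J).comap (formDel K) := by
    obtain ⟨hv, hdv⟩ := hv
    obtain ⟨l, rfl⟩ := Nat.exists_eq_add_of_le' hl
    refine ⟨add_mem (formD_mem_formsOfDegree a (formDel_mem_formsOfDegree hv))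
      (formDel_mem_formsOfDegree (formD_mem_formsOfDegree a hv)), ?_⟩
    have h := formLap_mem_formsWithCoeff a hJ hdv
    rw [formLap_apply, formDel_formDel, map_zero, zero_add] at h
    rwa [SetLike.mem_coe, Submodule.mem_comap, formLap_apply, map_add, formDel_formDel, add_zero]
  obtain ⟨w, hw, rfl⟩ := Module.End.exists_apply_eq_of_mem_polyTorsion hP ⟨hz, hdz⟩
    (formsOfDegree_le_polyTorsion a ha hl hz)
  exact ⟨formDel K w, hw.2, formD K a w, formD_mem_formsOfDegree a hw.1, formLap_apply a w⟩

end Forms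

section Reduction

variable {K : Type} [Field K] {n : ℕ} {R : Type} [CommRing R] [Algebra K R]
  (π : MvPolynomial (Fin n) K →ₐ[K] R)

variable (R) in
/-- The base change map from the exterior algebra of `K ^ n` to that of `R ^ n`. -/
noncomputable def exteriorReduction : ExteriorAlgebra K (Fin n → K) →ₐ[K]
    ExteriorAlgebra R (Fin n → R) :=
  ExteriorAlgebra.lift K ⟨(ι R).restrictScalars K ∘ₗ
    (Algebra.linearMap K R).compLeft (Fin n),
    fun _ => ι_sq_zero _⟩

theorem exteriorReduction_ι (v : Fin n → K) :
    exteriorReduction R (ι K v) =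
      ι R (fun s => algebraMap K R (v s)) :=
  ExteriorAlgebra.lift_ι_apply _ _ _ _

/-- Reduction of polynomial differential forms along `π`. -/
noncomputable def formReduction : Forms K n →ₐ[K]
    ExteriorAlgebra R (Fin n → R) :=
  Algebra.TensorProduct.lift
    (((Algebra.ofId R _).restrictScalars K).comp
      π)
    (exteriorReduction R) fun _ _ => Algebra.commutes _ _

theorem formReduction_tmul (f : MvPolynomial (Fin n) K) (x : ExteriorAlgebra K (Fin n → K)) :
    formReduction π (f ⊗ₜ x) = π f • exteriorReduction R x := by
  rw [Algebra.smul_def]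
  rfl

theorem contractLeft_exteriorReduction (s : Fin n) (x : ExteriorAlgebra K (Fin n → K)) :
    CliffordAlgebra.contractLeft
      (LinearMap.proj s : (Fin n → R) →ₗ[_] _) (exteriorReduction R x) =
      exteriorReduction R (coordContract K s x) := by
  induction x using CliffordAlgebra.left_induction with
  | algebraMap r =>
    have h : exteriorReduction R (algebraMap K (ExteriorAlgebra K (Fin n → K)) r) =
        algebraMap R _ (algebraMap K R r) := by
      rw [AlgHom.commutes, ← IsScalarTower.algebraMap_apply]
    rw [coordContract]
    erw [h, CliffordAlgebra.contractLeft_algebraMap, CliffordAlgebra.contractLeft_algebraMap]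
    rw [map_zero]
  | add x y hx hy => simp only [map_add, hx, hy]
  | ι_mul x v hx =>
    have h : coordContract K s (ι K v * x) = v s • x - ι K v * coordContract K s x :=
      CliffordAlgebra.contractLeft_ι_mul (Q := (0 : QuadraticForm K (Fin n → K))) _ _ _
    change CliffordAlgebra.contractLeft _ (exteriorReduction R (ι K v * x)) =
      exteriorReduction R (coordContract K s (ι K v * x))
    rw [h, map_mul (exteriorReduction R), map_sub, map_mul (exteriorReduction R), map_smul,
      exteriorReduction_ι, ← hx, ← algebraMap_smul R (v s)]
    exact CliffordAlgebra.contractLeft_ι_mul (Q := (0 : QuadraticForm R (Fin n → R))) _ _ _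

theorem koszulDiff_formReduction (z : Forms K n) :
    koszulDiff _ (fun s => π (X s)) (formReduction π z) =
      formReduction π (formDel K z) := by
  induction z using TensorProduct.induction_on with
  | zero => simp
  | add y z hy hz => simp only [map_add, hy, hz]
  | tmul f x =>
    rw [formDel_tmul, map_sum, koszulDiff, formReduction_tmul, map_smul, map_sum,
      LinearMap.sum_apply, Finset.smul_sum]
    refine Finset.sum_congr rfl fun s _ => ?_
    rw [map_smul, LinearMap.smul_apply, contractLeft_exteriorReduction, formReduction_tmul,
      smul_smul, ← map_mul, mul_comm]

theorem exteriorReduction_mem {l : ℕ} {x : ExteriorAlgebra K (Fin n → K)}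
    (hx : x ∈ ⋀[K]^l (Fin n → K)) :
    exteriorReduction R x ∈
      ⋀[R]^l (Fin n → R) := by
  induction hx using Submodule.pow_induction_on_left' with
  | algebraMap r =>
    rw [AlgHom.commutes, exteriorPower, pow_zero,
      IsScalarTower.algebraMap_apply K R]
    exact Submodule.algebraMap_mem _
  | add x y l _ _ hx hy => rw [map_add]; exact add_mem hx hy
  | mem_mul m hm l x _ hx =>
    obtain ⟨v, rfl⟩ := hm
    rw [map_mul, exteriorReduction_ι, exteriorPower, pow_succ']
    exact Submodule.mul_mem_mul ⟨_, rfl⟩ hx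

theorem formReduction_mem {l : ℕ} {z : Forms K n} (hz : z ∈ formsOfDegree K n l) :
    formReduction π z ∈
      ⋀[R]^l (Fin n → R) := by
  suffices h : formsOfDegree K n l ≤ ((⋀[R]^l
      (Fin n → R)).restrictScalars K).comap
      (formReduction π).toLinearMap from h hz
  refine Submodule.map₂_le.2 fun f _ x hx => ?_
  rw [Submodule.mem_comap, mk_apply, AlgHom.toLinearMap_apply, formReduction_tmul]
  exact Submodule.smul_mem _ _ (exteriorReduction_mem hx)

theorem formReduction_eq_zero {J : Ideal (MvPolynomial (Fin n) K)} (hJ : J ≤ RingHom.ker π)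
    {z : Forms K n} (hz : z ∈ formsWithCoeff J) : formReduction π z = 0 := by
  suffices h : formsWithCoeff J ≤ LinearMap.ker (formReduction π).toLinearMap from h hz
  refine Submodule.map₂_le.2 fun f hf x _ => ?_
  rw [LinearMap.mem_ker, mk_apply, AlgHom.toLinearMap_apply, formReduction_tmul,
    show π f = 0 from hJ hf, zero_smul]

theorem gen_mul_mem_formsOfDegree {l : ℕ} (g : Fin n → MvPolynomial (Fin n) K) {z : Forms K n}
    (hz : z ∈ formsOfDegree K n l) :
    (∑ s, g s ⊗ₜ[K] gen K s) * z ∈ formsOfDegree K n (l + 1) := by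
  suffices h : formsOfDegree K n l ≤ (formsOfDegree K n (l + 1)).comap
      (LinearMap.mulLeft K (∑ s, g s ⊗ₜ[K] gen K s)) from h hz
  refine Submodule.map₂_le.2 fun f _ x hx => ?_
  rw [Submodule.mem_comap, mk_apply, LinearMap.mulLeft_apply, Finset.sum_mul]
  refine sum_mem fun s _ => ?_
  rw [Algebra.TensorProduct.tmul_mul_tmul]
  refine tmul_mem_formsOfDegree _ ?_
  rw [exteriorPower, pow_succ']
  exact Submodule.mul_mem_mul ⟨_, rfl⟩ hx

theorem formReduction_sum_tmul_gen (g : Fin n → MvPolynomial (Fin n) K) :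
    formReduction π (∑ s, g s ⊗ₜ[K] gen K s) = ι _ (fun s => π (g s)) := by
  rw [map_sum]
  conv_rhs => rw [pi_eq_sum_univ' (fun s => π (g s)), map_sum]
  refine Finset.sum_congr rfl fun s _ => ?_
  rw [formReduction_tmul, gen, exteriorReduction_ι, map_smul]
  congr 2
  ext t
  simp only [Pi.single_apply]
  split_ifs <;> simp

theorem exists_formReduction_eq (hπ : Function.Surjective π) {l : ℕ}
    {z : ExteriorAlgebra R (Fin n → R)}
    (hz : z ∈ ⋀[R]^l (Fin n → R)) :
    ∃ y ∈ formsOfDegree K n l, formReduction π y = z := by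
  induction hz using Submodule.pow_induction_on_left' with
  | algebraMap r =>
    obtain ⟨f, rfl⟩ := hπ r
    refine ⟨f ⊗ₜ 1, tmul_mem_formsOfDegree _ ?_, ?_⟩
    · rw [exteriorPower, pow_zero]
      exact Submodule.one_le.1 le_rfl
    · rw [formReduction_tmul, map_one, Algebra.algebraMap_eq_smul_one]
  | add x y l _ _ hx hy =>
    obtain ⟨x, hx, rfl⟩ := hx
    obtain ⟨y, hy, rfl⟩ := hy
    exact ⟨x + y, add_mem hx hy, map_add _ _ _⟩
  | mem_mul m hm l x _ hx =>
    obtain ⟨v, rfl⟩ := hm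
    obtain ⟨x, hx, rfl⟩ := hx
    choose g hg using fun s => hπ (v s)
    refine ⟨_, gen_mul_mem_formsOfDegree g hx, ?_⟩
    rw [map_mul, formReduction_sum_tmul_gen]
    simp only [hg]

variable [CharZero K]

variable (K n R) in
/-- The comparison map from the exterior algebra of `R ^ n` to the base change of the
exterior algebra of `K ^ n`. -/
noncomputable def toBaseChange :
    ExteriorAlgebra R (Fin n → R) →ₐ[
      R]
      R ⊗[K] ExteriorAlgebra K (Fin n → K) :=
  ExteriorAlgebra.lift _ ⟨∑ s, (LinearMap.toSpanSingleton _ _ (1 ⊗ₜ gen K s)) ∘ₗ LinearMap.proj s,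
    fun v => by
      refine eq_zero_of_eq_neg K ?_
      simp only [LinearMap.sum_apply, LinearMap.comp_apply, LinearMap.proj_apply,
        LinearMap.toSpanSingleton_apply, Finset.sum_mul_sum, ← Finset.sum_neg_distrib]
      rw [Finset.sum_comm]
      refine Finset.sum_congr rfl fun s _ => Finset.sum_congr rfl fun t _ => ?_
      rw [smul_mul_smul_comm, smul_mul_smul_comm, Algebra.TensorProduct.tmul_mul_tmul,
        Algebra.TensorProduct.tmul_mul_tmul, gen_mul_gen_comm, tmul_neg, smul_neg,
        mul_comm (v t)]⟩

theorem toBaseChange_exteriorReduction (x : ExteriorAlgebra K (Fin n → K)) :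
    toBaseChange K n R (exteriorReduction R x) = 1 ⊗ₜ x := by
  suffices h : ((toBaseChange K n R).restrictScalars K).comp (exteriorReduction R) =
      Algebra.TensorProduct.includeRight from DFunLike.congr_fun h x
  refine ExteriorAlgebra.hom_ext (LinearMap.ext fun v => ?_)
  change toBaseChange K n R (exteriorReduction R (ι K v)) = 1 ⊗ₜ ι K v
  rw [exteriorReduction_ι, toBaseChange, ExteriorAlgebra.lift_ι_apply, ι_eq_sum_gen, tmul_sum]
  simp [LinearMap.sum_apply, LinearMap.toSpanSingleton_apply]

theorem toBaseChange_formReduction (z : Forms K n) :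
    toBaseChange K n R (formReduction π z) =
      LinearMap.rTensor _ π.toLinearMap z := by
  induction z using TensorProduct.induction_on with
  | zero => simp
  | add y z hy hz => simp only [map_add, hy, hz]
  | tmul f x =>
    rw [formReduction_tmul, map_smul, toBaseChange_exteriorReduction, smul_tmul', smul_eq_mul,
      mul_one]
    rfl

theorem mem_formsWithCoeff_of_formReduction_eq_zero (hπ : Function.Surjective π)
    {z : Forms K n} (hz : formReduction π z = 0) : z ∈ formsWithCoeff (RingHom.ker π) := by
  have hexact : Function.Exact ((RingHom.ker π).restrictScalars K).subtype
      π.toLinearMap := by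
    intro f
    simp [RingHom.mem_ker]
  have h := rTensor_exact (ExteriorAlgebra K (Fin n → K)) hexact
    (hπ) z
  rw [← toBaseChange_formReduction, hz, map_zero] at h
  obtain ⟨y, rfl⟩ := h.1 rfl
  clear h hz
  induction y using TensorProduct.induction_on with
  | zero => rw [map_zero]; exact zero_mem _
  | add x y hx hy => rw [map_add]; exact add_mem hx hy
  | tmul f x => exact tmul_mem_formsWithCoeff f.2 x

end Reduction

end MvPolynomial

section KoszulComplex

variable {R : Type} [CommRing R] {n : ℕ} (x : Fin n → R)

theorem koszulDiff_koszulDiff (z : ExteriorAlgebra R (Fin n → R)) :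
    koszulDiff R x (koszulDiff R x z) = 0 :=
  CliffordAlgebra.contractLeft_contractLeft (Q := (0 : QuadraticForm R (Fin n → R))) _ _

variable {x}

theorem koszulDiff_mem {l : ℕ} {z : ExteriorAlgebra R (Fin n → R)}
    (hz : z ∈ ⋀[R]^(l + 1) (Fin n → R)) : koszulDiff R x z ∈ ⋀[R]^l (Fin n → R) :=
  ExteriorAlgebra.contractLeft_mem_exteriorPower _ hz

theorem koszulDiff_mem_koszulBoundaries {l : ℕ} {u : ExteriorAlgebra R (Fin n → R)}
    (hu : u ∈ ⋀[R]^(l + 1) (Fin n → R)) : koszulDiff R x u ∈ koszulBoundaries R x l :=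
  Submodule.mem_map_of_mem hu

theorem koszulBoundaries_le_koszulCycles (l : ℕ) :
    koszulBoundaries R x l ≤ koszulCycles R x l := by
  rintro _ ⟨u, hu, rfl⟩
  exact ⟨koszulDiff_mem hu, koszulDiff_koszulDiff x u⟩

theorem mul_mem_exteriorPower {i j : ℕ} {y z : ExteriorAlgebra R (Fin n → R)}
    (hy : y ∈ ⋀[R]^i (Fin n → R)) (hz : z ∈ ⋀[R]^j (Fin n → R)) :
    y * z ∈ ⋀[R]^(i + j) (Fin n → R) := by
  rw [ExteriorAlgebra.exteriorPower, pow_add]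
  exact Submodule.mul_mem_mul hy hz

theorem koszulBoundaries_mul_koszulCycles {i j : ℕ} {y z : ExteriorAlgebra R (Fin n → R)}
    (hy : y ∈ koszulBoundaries R x i) (hz : z ∈ koszulCycles R x j) :
    y * z ∈ koszulBoundaries R x (i + j) := by
  obtain ⟨u, hu, rfl⟩ := hy
  refine ⟨u * z, ?_, ?_⟩
  · rw [add_right_comm]
    exact mul_mem_exteriorPower hu hz.1
  · have h := ExteriorAlgebra.contractLeft_mul_of_mem_exteriorPower
      (∑ s, x s • LinearMap.proj s) hu z
    have hz' : CliffordAlgebra.contractLeft (∑ s, x s • LinearMap.proj s) z = 0 := hz.2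
    rwa [hz', mul_zero, mul_zero, add_zero] at h

theorem koszulCycles_mul_koszulBoundaries {i j : ℕ} {y z : ExteriorAlgebra R (Fin n → R)}
    (hy : y ∈ koszulCycles R x i) (hz : z ∈ koszulBoundaries R x j) :
    y * z ∈ koszulBoundaries R x (i + j) := by
  obtain ⟨u, hu, rfl⟩ := hz
  have h := ExteriorAlgebra.contractLeft_mul_of_mem_exteriorPower
    (∑ s, x s • LinearMap.proj s) hy.1 u
  have hy' : CliffordAlgebra.contractLeft (∑ s, x s • LinearMap.proj s) y = 0 := hy.2
  rw [hy', zero_mul, zero_add] at h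
  have hmem : koszulDiff R x (y * u) ∈ koszulBoundaries R x (i + j) :=
    koszulDiff_mem_koszulBoundaries (by rw [add_assoc]; exact mul_mem_exteriorPower hy.1 hu)
  have heq : y * koszulDiff R x u = (-1 : R) ^ i • koszulDiff R x (y * u) := by
    have h1 : koszulDiff R x (y * u) = (-1 : R) ^ i • (y * koszulDiff R x u) := by
      refine h.trans ?_
      rw [Algebra.smul_def, map_pow, map_neg, map_one]
      rfl
    rw [h1, smul_smul, ← mul_pow, neg_one_mul, neg_neg, one_pow, one_smul]
  rw [heq]
  exact Submodule.smul_mem _ _ hmem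

end KoszulComplex

/-- A Koszul cycle of positive degree over `S ⧸ I ^ (k + 1)` is homologous to the reduction of a
form with coefficients in `I ^ k`. -/
theorem MvPolynomial.exists_sub_formReduction_mem_koszulBoundaries {K : Type} [Field K]
    [CharZero K] {n : ℕ} {a : Fin n → ℕ} (ha : ∀ s, 0 < a s) {I : Ideal (MvPolynomial (Fin n) K)}
    (hI : ∀ f ∈ I, ∀ d : ℕ, weightedHomogeneousComponent a d f ∈ I) {k l : ℕ} (hl : 1 ≤ l)
    {R : Type} [CommRing R] [Algebra K R] {π : MvPolynomial (Fin n) K →ₐ[K] R}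
    (hπ : Function.Surjective π) (hker : RingHom.ker π = I ^ (k + 1))
    {z : ExteriorAlgebra R (Fin n → R)} (hz : z ∈ koszulCycles R (fun s => π (X s)) l) :
    ∃ w ∈ formsWithCoeff (I ^ k),
      z - formReduction π w ∈ koszulBoundaries R (fun s => π (X s)) l := by
  obtain ⟨y, hy, rfl⟩ := exists_formReduction_eq π hπ hz.1
  have hdy : formReduction π (formDel K y) = 0 := by
    rw [← koszulDiff_formReduction]
    exact hz.2
  have hdy := mem_formsWithCoeff_of_formReduction_eq_zero π hπ hdy
  rw [hker] at hdy
  obtain ⟨v, hv, u, hu, rfl⟩ := exists_eq_formD_add_formDel a ha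
    (fun f hf => (eulerDerivation a).apply_mem_pow (fun _ => eulerDerivation_mem a hI) _ hf)
    hl hy hdy
  refine ⟨formD K a v, formD_mem_formsWithCoeff a
    (fun f hf s => (pderiv s).apply_mem_pow_of_mem_pow_succ k hf) hv, ?_⟩
  rw [map_add, add_sub_cancel_left, ← koszulDiff_formReduction]
  exact koszulDiff_mem_koszulBoundaries (formReduction_mem π hu)

/-- Let `K` be a field of characteristic `0`, `S = K[x_1, …, x_n]` a positively graded
polynomial ring with `deg x_i = a_i > 0`, `I ⊂ S` a proper graded ideal, and `k ≥ 2` an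
integer.  Then the Koszul homology `H(x; S/I^k)` of `R = S/I^k` with respect to
`x = x_1, …, x_n` has trivial multiplication: for all `i, j ≥ 1` and all homology
classes `h_1 ∈ H_i(x; R)`, `h_2 ∈ H_j(x; R)`, the product `h_1 · h_2 = 0` in
`H_{i+j}(x; R)`; equivalently, for all cycles `z_1 ∈ Z_i(R)` and `z_2 ∈ Z_j(R)`
(representing `h_1` and `h_2`), the wedge product `z_1 ∧ z_2` is a boundary. -/
theorem powers_koszul_homology_trivial_multiplication
    (K : Type) [Field K] [CharZero K] (n : ℕ)
    (a : Fin n → ℕ) (ha : ∀ i, 0 < a i)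
    (I : Ideal (MvPolynomial (Fin n) K)) (hI : I ≠ ⊤)
    (hIhom : ∀ f ∈ I, ∀ d : ℕ, MvPolynomial.weightedHomogeneousComponent a d f ∈ I)
    (k : ℕ) (hk : 2 ≤ k) (i j : ℕ) (hi : 1 ≤ i) (hj : 1 ≤ j)
    (z₁ z₂ : ExteriorAlgebra (MvPolynomial (Fin n) K ⧸ I ^ k)
      (Fin n → MvPolynomial (Fin n) K ⧸ I ^ k))
    (hz₁ : z₁ ∈ koszulCycles (MvPolynomial (Fin n) K ⧸ I ^ k)
      (fun s => Ideal.Quotient.mk (I ^ k) (MvPolynomial.X s)) i)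
    (hz₂ : z₂ ∈ koszulCycles (MvPolynomial (Fin n) K ⧸ I ^ k)
      (fun s => Ideal.Quotient.mk (I ^ k) (MvPolynomial.X s)) j) :
    z₁ * z₂ ∈ koszulBoundaries (MvPolynomial (Fin n) K ⧸ I ^ k)
      (fun s => Ideal.Quotient.mk (I ^ k) (MvPolynomial.X s)) (i + j) := by
  obtain ⟨k, rfl⟩ := Nat.exists_eq_add_of_le' (one_le_two.trans hk)
  have hker : RingHom.ker (Ideal.Quotient.mkₐ K (I ^ (k + 1))) = I ^ (k + 1) :=
    Ideal.Quotient.mkₐ_ker K _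
  obtain ⟨w₁, hw₁, h₁⟩ := MvPolynomial.exists_sub_formReduction_mem_koszulBoundaries ha hIhom hi
    (Ideal.Quotient.mkₐ_surjective K _) hker hz₁
  obtain ⟨w₂, hw₂, h₂⟩ := MvPolynomial.exists_sub_formReduction_mem_koszulBoundaries ha hIhom hj
    (Ideal.Quotient.mkₐ_surjective K _) hker hz₂
  set π := Ideal.Quotient.mkₐ K (I ^ (k + 1))
  have hle : I ^ k * I ^ k ≤ RingHom.ker π := by
    rw [hker, ← pow_add]
    exact Ideal.pow_le_pow_right (by omega)
  have hw : MvPolynomial.formReduction π w₁ * MvPolynomial.formReduction π w₂ = 0 := by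
    rw [← map_mul]
    exact MvPolynomial.formReduction_eq_zero π hle
      (MvPolynomial.mul_mem_formsWithCoeff hw₁ hw₂)
  have hcycle : MvPolynomial.formReduction π w₂ ∈
      koszulCycles _ (fun s => Ideal.Quotient.mk (I ^ (k + 1)) (MvPolynomial.X s)) j :=
    (Submodule.sub_mem_iff_right _ hz₂).1 (koszulBoundaries_le_koszulCycles _ h₂)
  have heq : z₁ * z₂ = z₁ * (z₂ - MvPolynomial.formReduction π w₂) +
      (z₁ - MvPolynomial.formReduction π w₁) * MvPolynomial.formReduction π w₂ := by
    rw [mul_sub, sub_mul, hw, sub_zero, sub_add_cancel]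
  rw [heq]
  exact add_mem (koszulCycles_mul_koszulBoundaries hz₁ h₂)
    (koszulBoundaries_mul_koszulCycles h₁ hcycle)
end

section
/- Let K be a field of characteristic 0, S = K[x_1, …, x_n] a positively graded polynomial ring with deg x_i = a_i > 0, I ⊂ S a proper graded ideal, k ≥ 1 an integer, and set R = S/I^k. Then for every l ≥ 1, every homology class in H_l(x; R) can be represented by a cycle z ∈ Z_l(R) that lies in I^{k−1}·K_l(R), i.e. a cycle all of whose coefficients (with respect to the basis e_{i_1}∧⋯∧e_{i_l} of K_l(R)) lie in the image of I^{k−1} in R. -/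
set_option synthInstance.maxHeartbeats 1000000
set_option maxHeartbeats 1000000

namespace KoszulPower

open TensorProduct MvPolynomial

section Operators

variable (K : Type) [Field K] {n : ℕ}

/-- Contraction of `⋀ Kⁿ` by the `i`-th coordinate functional. -/
noncomputable def contract (i : Fin n) : Module.End K (ExteriorAlgebra K (Fin n → K)) :=
  CliffordAlgebra.contractLeft (LinearMap.proj i)

/-- Left multiplication by the `i`-th basis vector on `⋀ Kⁿ`. -/
noncomputable def wedge (i : Fin n) : Module.End K (ExteriorAlgebra K (Fin n → K)) :=
  LinearMap.mulLeft K (ExteriorAlgebra.ι K (Pi.single i 1))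

/-- The operator `∑ aᵢ eᵢ ∧ ιᵢ`, acting on `e_{i₁} ∧ ⋯ ∧ e_{iₗ}` as `a_{i₁} + ⋯ + a_{iₗ}`. -/
noncomputable def weightOp (a : Fin n → ℕ) : Module.End K (ExteriorAlgebra K (Fin n → K)) :=
  ∑ i, (a i : K) • (wedge K i * contract K i)

/-- The weighted Euler derivation `∑ aᵢ xᵢ ∂ᵢ`. -/
noncomputable def eulerDerivation (a : Fin n → ℕ) :
    Derivation K (MvPolynomial (Fin n) K) (MvPolynomial (Fin n) K) :=
  ∑ i, (a i : K) • ((X i : MvPolynomial (Fin n) K) • pderiv i)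

/-- The Koszul differential on `S ⊗ ⋀ Kⁿ`. -/
noncomputable def koszulTensor :
    Module.End K (MvPolynomial (Fin n) K ⊗[K] ExteriorAlgebra K (Fin n → K)) :=
  ∑ i, TensorProduct.map (LinearMap.mulLeft K (X i)) (contract K i)

/-- The de Rham differential on `S ⊗ ⋀ Kⁿ`, in the basis `eᵢ = dxᵢ / aᵢ`. -/
noncomputable def deRham (a : Fin n → ℕ) :
    Module.End K (MvPolynomial (Fin n) K ⊗[K] ExteriorAlgebra K (Fin n → K)) :=
  ∑ i, (a i : K) • TensorProduct.map (pderiv i).toLinearMap (wedge K i)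

/-- The Lie derivative along the weighted Euler vector field. -/
noncomputable def lieEuler (a : Fin n → ℕ) :
    Module.End K (MvPolynomial (Fin n) K ⊗[K] ExteriorAlgebra K (Fin n → K)) :=
  deRham K a * koszulTensor K + koszulTensor K * deRham K a

variable {K}

theorem lieEuler_apply (a : Fin n → ℕ)
    (w : MvPolynomial (Fin n) K ⊗[K] ExteriorAlgebra K (Fin n → K)) :
    lieEuler K a w = deRham K a (koszulTensor K w) + koszulTensor K (deRham K a w) :=
  rfl

theorem eulerDerivation_apply (a : Fin n → ℕ) (f : MvPolynomial (Fin n) K) :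
    eulerDerivation K a f = ∑ i, (a i : K) • (X i * pderiv i f) := by
  rw [eulerDerivation, ← Derivation.coeFnAddMonoidHom_apply, map_sum, Finset.sum_apply]
  rfl

theorem contract_wedge (i j : Fin n) (u : ExteriorAlgebra K (Fin n → K)) :
    contract K i (wedge K j u) = (if i = j then u else 0) - wedge K j (contract K i u) := by
  simp only [contract, wedge, LinearMap.mulLeft_apply]
  refine (CliffordAlgebra.contractLeft_ι_mul _ _ _).trans ?_
  congr 1
  simp [Pi.single_apply]

theorem contract_comm (i j : Fin n) (u : ExteriorAlgebra K (Fin n → K)) :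
    contract K i (contract K j u) = - contract K j (contract K i u) :=
  CliffordAlgebra.contractLeft_comm _ _ _

theorem sum_sum_eq_zero_of_antisymm [CharZero K] {M : Type*} [AddCommGroup M] [Module K M]
    (F : Fin n → Fin n → M) (hF : ∀ i j, F i j = - F j i) : ∑ i, ∑ j, F i j = 0 := by
  have h : ∑ i, ∑ j, F i j = - ∑ i, ∑ j, F i j := by
    conv_lhs => rw [Finset.sum_comm]
    simp only [← Finset.sum_neg_distrib]
    exact Finset.sum_congr rfl fun i _ => Finset.sum_congr rfl fun j _ => hF j i
  have h2 : (2 : K) • ∑ i, ∑ j, F i j = 0 := by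
    rw [two_smul]
    nth_rewrite 1 [h]
    simp
  exact (smul_eq_zero.mp h2).resolve_left two_ne_zero

theorem koszulTensor_tmul (f : MvPolynomial (Fin n) K) (u : ExteriorAlgebra K (Fin n → K)) :
    koszulTensor K (f ⊗ₜ u) = ∑ i, (X i * f) ⊗ₜ contract K i u := by
  simp [koszulTensor]

theorem deRham_tmul (a : Fin n → ℕ) (f : MvPolynomial (Fin n) K)
    (u : ExteriorAlgebra K (Fin n → K)) :
    deRham K a (f ⊗ₜ u) = ∑ i, (a i : K) • (pderiv i f) ⊗ₜ wedge K i u := by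
  simp [deRham]

theorem koszulTensor_koszulTensor [CharZero K]
    (w : MvPolynomial (Fin n) K ⊗[K] ExteriorAlgebra K (Fin n → K)) :
    koszulTensor K (koszulTensor K w) = 0 := by
  induction w with
  | zero => simp
  | add x y hx hy => simp [hx, hy]
  | tmul f u =>
    simp only [koszulTensor_tmul, map_sum]
    refine sum_sum_eq_zero_of_antisymm (K := K) _ fun i j => ?_
    rw [contract_comm, TensorProduct.tmul_neg, mul_left_comm]

/-- Cartan's formula for the weighted Euler vector field. -/
theorem lieEuler_tmul (a : Fin n → ℕ) (f : MvPolynomial (Fin n) K)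
    (u : ExteriorAlgebra K (Fin n → K)) :
    lieEuler K a (f ⊗ₜ u) =
      eulerDerivation K a f ⊗ₜ u + f ⊗ₜ weightOp K a u := by
  classical
  have h₁ : deRham K a (koszulTensor K (f ⊗ₜ u)) =
      ∑ i, ∑ j, (a j : K) • (((if i = j then f else 0) ⊗ₜ wedge K j (contract K i u) :
        MvPolynomial (Fin n) K ⊗[K] ExteriorAlgebra K (Fin n → K)) +
        (X i * pderiv j f) ⊗ₜ wedge K j (contract K i u)) := by
    simp only [koszulTensor_tmul, map_sum, deRham_tmul]
    refine Finset.sum_congr rfl fun i _ => Finset.sum_congr rfl fun j _ => ?_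
    rw [← TensorProduct.add_tmul, pderiv_mul, pderiv_X, Pi.single_apply]
    congr 3
    by_cases h : i = j <;> simp [h]
  have h₂ : koszulTensor K (deRham K a (f ⊗ₜ u)) =
      ∑ i, ∑ j, (a j : K) • ((X i * pderiv j f) ⊗ₜ[K] (if i = j then u else 0) -
        (X i * pderiv j f) ⊗ₜ[K] wedge K j (contract K i u)) := by
    simp only [koszulTensor_tmul, map_sum, deRham_tmul, map_smul]
    simp only [Finset.smul_sum]
    rw [Finset.sum_comm]
    refine Finset.sum_congr rfl fun i _ => Finset.sum_congr rfl fun j _ => ?_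
    rw [contract_wedge, TensorProduct.tmul_sub]
  rw [lieEuler_apply, h₁, h₂, ← Finset.sum_add_distrib]
  simp only [← Finset.sum_add_distrib, ← smul_add, add_add_sub_cancel]
  have h₃ (i j : Fin n) : ((if i = j then f else 0) ⊗ₜ wedge K j (contract K i u) :
      MvPolynomial (Fin n) K ⊗[K] ExteriorAlgebra K (Fin n → K)) =
      if i = j then f ⊗ₜ wedge K j (contract K i u) else 0 := by
    split_ifs <;> simp
  have h₄ (i j : Fin n) : (X i * pderiv j f) ⊗ₜ[K] (if i = j then u else 0) =
      if i = j then (X i * pderiv j f) ⊗ₜ[K] u else 0 := by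
    split_ifs <;> simp
  simp only [h₃, h₄, smul_add, smul_ite, smul_zero, Finset.sum_add_distrib, Finset.sum_ite_eq,
    Finset.mem_univ, if_true]
  rw [add_comm]
  congr 1
  · simp [eulerDerivation_apply, TensorProduct.sum_tmul, TensorProduct.smul_tmul']
  · simp [weightOp, TensorProduct.tmul_sum]

theorem wedge_comm (i j : Fin n) (u : ExteriorAlgebra K (Fin n → K)) :
    wedge K i (wedge K j u) = - wedge K j (wedge K i u) := by
  simp only [wedge, LinearMap.mulLeft_apply, ← mul_assoc]
  rw [← neg_mul, eq_neg_of_add_eq_zero_left (ExteriorAlgebra.ι_add_mul_swap _ _)]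

theorem weightOp_wedge (a : Fin n → ℕ) (j : Fin n) (u : ExteriorAlgebra K (Fin n → K)) :
    weightOp K a (wedge K j u) = (a j : K) • wedge K j u + wedge K j (weightOp K a u) := by
  classical
  simp only [weightOp, LinearMap.sum_apply, LinearMap.smul_apply, Module.End.mul_apply,
    contract_wedge, map_sub, map_sum, map_smul, smul_sub, Finset.sum_sub_distrib]
  rw [sub_eq_add_neg, ← Finset.sum_neg_distrib]
  congr 1
  · rw [Finset.sum_eq_single j] <;> simp +contextual
  · exact Finset.sum_congr rfl fun i _ => by rw [wedge_comm i j, smul_neg, neg_neg]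

theorem ι_mul_eq_sum_wedge (v : Fin n → K) (u : ExteriorAlgebra K (Fin n → K)) :
    ExteriorAlgebra.ι K v * u = ∑ j, v j • wedge K j u := by
  conv_lhs => rw [pi_eq_sum_univ' v]
  simp [wedge, Finset.sum_mul]

theorem wedge_mem {l : ℕ} (i : Fin n) {u : ExteriorAlgebra K (Fin n → K)}
    (hu : u ∈ ⋀[K]^l (Fin n → K)) : wedge K i u ∈ ⋀[K]^(l + 1) (Fin n → K) := by
  rw [ExteriorAlgebra.exteriorPower, pow_succ']
  exact Submodule.mul_mem_mul (LinearMap.mem_range_self _ _) hu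

theorem contract_algebraMap (i : Fin n) (r : K) :
    contract K i (algebraMap K (ExteriorAlgebra K (Fin n → K)) r) = 0 :=
  CliffordAlgebra.contractLeft_algebraMap _ _ r

theorem contract_ι_mul (i : Fin n) (v : Fin n → K) (u : ExteriorAlgebra K (Fin n → K)) :
    contract K i (ExteriorAlgebra.ι K v * u) =
      v i • u - ExteriorAlgebra.ι K v * contract K i u :=
  CliffordAlgebra.contractLeft_ι_mul _ _ _

theorem contract_mem {l : ℕ} (i : Fin n) {u : ExteriorAlgebra K (Fin n → K)}
    (hu : u ∈ ⋀[K]^(l + 1) (Fin n → K)) : contract K i u ∈ ⋀[K]^l (Fin n → K) := by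
  induction l generalizing u with
  | zero =>
    rw [ExteriorAlgebra.exteriorPower, pow_succ'] at hu
    refine Submodule.mul_induction_on hu ?_ fun x y hx hy => by
      rw [map_add]; exact add_mem hx hy
    rintro _ ⟨v, rfl⟩ y hy
    rw [pow_zero] at hy
    obtain ⟨r, rfl⟩ := Submodule.mem_one.mp hy
    rw [contract_ι_mul, contract_algebraMap, mul_zero, sub_zero]
    exact Submodule.smul_mem _ _ (by rw [ExteriorAlgebra.exteriorPower, pow_zero]; exact hy)
  | succ l ih =>
    rw [ExteriorAlgebra.exteriorPower, pow_succ'] at hu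
    refine Submodule.mul_induction_on hu ?_ fun x y hx hy => by
      rw [map_add]; exact add_mem hx hy
    rintro _ ⟨v, rfl⟩ y hy
    rw [contract_ι_mul]
    refine sub_mem (Submodule.smul_mem _ _ hy) ?_
    rw [ExteriorAlgebra.exteriorPower, pow_succ']
    exact Submodule.mul_mem_mul (LinearMap.mem_range_self _ _) (ih hy)

theorem weightOp_mem (a : Fin n → ℕ) {l : ℕ} {u : ExteriorAlgebra K (Fin n → K)}
    (hu : u ∈ ⋀[K]^(l + 1) (Fin n → K)) : weightOp K a u ∈ ⋀[K]^(l + 1) (Fin n → K) := by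
  simp only [weightOp, LinearMap.sum_apply, LinearMap.smul_apply, Module.End.mul_apply]
  exact sum_mem fun i _ => Submodule.smul_mem _ _ (wedge_mem i (contract_mem i hu))

theorem exteriorPower_le_span_weightOp_eigenvectors (a : Fin n → ℕ) (ha : ∀ i, 0 < a i) (l : ℕ) :
    ⋀[K]^l (Fin n → K) ≤
      Submodule.span K {u | ∃ c : ℕ, l ≤ c ∧ weightOp K a u = (c : K) • u} := by
  induction l with
  | zero =>
    intro u hu
    rw [ExteriorAlgebra.exteriorPower, pow_zero] at hu
    obtain ⟨r, rfl⟩ := Submodule.mem_one.mp hu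
    refine Submodule.subset_span ⟨0, le_rfl, ?_⟩
    simp [weightOp, contract_algebraMap]
  | succ l ih =>
    rw [ExteriorAlgebra.exteriorPower, pow_succ', Submodule.mul_le]
    rintro _ ⟨v, rfl⟩ y hy
    replace hy := ih hy
    induction hy using Submodule.span_induction with
    | zero => simp
    | add x y _ _ hx hy => rw [mul_add]; exact add_mem hx hy
    | smul r x _ hx => rw [mul_smul_comm]; exact Submodule.smul_mem _ _ hx
    | mem u hu =>
      obtain ⟨c, hc, hu⟩ := hu
      rw [ι_mul_eq_sum_wedge]
      refine sum_mem fun j _ => Submodule.smul_mem _ _ (Submodule.subset_span ⟨a j + c, ?_, ?_⟩)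
      · have := ha j
        omega
      · rw [weightOp_wedge, hu, map_smul, Nat.cast_add, add_smul]

theorem eulerDerivation_mem (a : Fin n → ℕ) {I : Ideal (MvPolynomial (Fin n) K)}
    (hI : ∀ f ∈ I, ∀ d : ℕ, weightedHomogeneousComponent a d f ∈ I)
    {f : MvPolynomial (Fin n) K} (hf : f ∈ I) : eulerDerivation K a f ∈ I := by
  have h := sum_weightedHomogeneousComponent a f
  rw [finsum_eq_sum _ (weightedHomogeneousComponent_finsupp f)] at h
  rw [← h, map_sum]
  refine sum_mem fun d _ => ?_
  have e : eulerDerivation K a (weightedHomogeneousComponent a d f) =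
      d • weightedHomogeneousComponent a d f := by
    rw [← (weightedHomogeneousComponent_isWeightedHomogeneous d f).sum_weight_X_mul_pderiv,
      eulerDerivation_apply]
    simp only [Nat.cast_smul_eq_nsmul]
  rw [e]
  exact nsmul_mem (hI f hf d) d

end Operators

section Derivations

variable {K A : Type*} [CommRing K] [CommRing A] [Algebra K A] (D : Derivation K A A)
  {I : Ideal A}

theorem derivation_mem_pow_of_mem_pow_succ {m : ℕ} {f : A} (hf : f ∈ I ^ (m + 1)) :
    D f ∈ I ^ m := by
  induction m generalizing f with
  | zero => simp
  | succ m ih =>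
    rw [pow_succ] at hf
    refine Submodule.mul_induction_on hf (fun x hx y hy => ?_) fun x y hx hy => by
      rw [map_add]; exact add_mem hx hy
    rw [D.leibniz, smul_eq_mul, smul_eq_mul]
    refine add_mem (Ideal.mul_mem_right _ _ hx) ?_
    rw [mul_comm, pow_succ]
    exact Ideal.mul_mem_mul (ih hx) hy

theorem derivation_mem_pow (hD : ∀ f ∈ I, D f ∈ I) {m : ℕ} {f : A} (hf : f ∈ I ^ m) :
    D f ∈ I ^ m := by
  induction m generalizing f with
  | zero => simp
  | succ m ih =>
    rw [pow_succ] at hf ⊢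
    refine Submodule.mul_induction_on hf (fun x hx y hy => ?_) fun x y hx hy => by
      rw [map_add]; exact add_mem hx hy
    rw [D.leibniz, smul_eq_mul, smul_eq_mul, mul_comm y]
    exact add_mem (Ideal.mul_mem_mul hx (hD y hy)) (Ideal.mul_mem_mul (ih hx) hy)

end Derivations

section Polynomials

variable {K V : Type*} [Field K] [AddCommGroup V] [Module K V]

theorem aeval_mem_of_mapsTo (T : Module.End K V) {U : Submodule K V} (hU : ∀ w ∈ U, T w ∈ U)
    (p : Polynomial K) {w : V} (hw : w ∈ U) : Polynomial.aeval T p w ∈ U := by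
  induction p using Polynomial.induction_on' generalizing w with
  | add p q hp hq =>
    rw [map_add, LinearMap.add_apply]
    exact add_mem (hp hw) (hq hw)
  | monomial m r =>
    rw [Polynomial.aeval_monomial, Module.End.mul_apply, Module.algebraMap_end_apply]
    refine Submodule.smul_mem _ _ ?_
    induction m with
    | zero => simpa
    | succ m ih =>
      rw [pow_succ', Module.End.mul_apply]
      exact hU _ ih

/-- A linear map is invertible, via a polynomial in itself, on any sum of eigenvectors with
nonzero eigenvalues. -/
theorem exists_aeval_apply_eq_self (T : Module.End K V) {w : V}
    (hw : w ∈ Submodule.span K {v | ∃ c : K, c ≠ 0 ∧ T v = c • v}) :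
    ∃ p : Polynomial K, Polynomial.aeval T p (T w) = w := by
  have h : ∃ q : Polynomial K, q.coeff 0 ≠ 0 ∧ Polynomial.aeval T q w = 0 := by
    induction hw using Submodule.span_induction with
    | zero => exact ⟨1, by simp, by simp⟩
    | mem v hv =>
      obtain ⟨c, hc, hv⟩ := hv
      exact ⟨Polynomial.X - Polynomial.C c, by simpa using hc, by simp [hv]⟩
    | smul r v _ hv =>
      obtain ⟨q, hq, hv⟩ := hv
      exact ⟨q, hq, by rw [map_smul, hv, smul_zero]⟩
    | add u v _ _ hu hv =>
      obtain ⟨q, hq, hu⟩ := hu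
      obtain ⟨r, hr, hv⟩ := hv
      refine ⟨q * r, by rw [Polynomial.mul_coeff_zero]; exact mul_ne_zero hq hr, ?_⟩
      rw [map_add, map_mul, Module.End.mul_apply, Module.End.mul_apply, hv, map_zero, add_zero,
        ← Module.End.mul_apply, ← map_mul, mul_comm, map_mul, Module.End.mul_apply, hu, map_zero]
  obtain ⟨q, hq, h⟩ := h
  refine ⟨Polynomial.C (-(q.coeff 0)⁻¹) * q.divX, ?_⟩
  rw [← q.divX_mul_X_add] at h
  simp only [map_add, map_mul, Polynomial.aeval_X, Polynomial.aeval_C, LinearMap.add_apply,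
    Module.End.mul_apply, Module.algebraMap_end_apply] at h ⊢
  rw [eq_neg_of_add_eq_zero_left h, smul_neg, neg_smul, neg_neg, smul_smul, inv_mul_cancel₀ hq,
    one_smul]

end Polynomials

section Homotopy

variable {K : Type} [Field K] {n : ℕ}

/-- The image of `J ⊗ L` in `S ⊗ ⋀ Kⁿ`. -/
noncomputable def tensorSub (J : Ideal (MvPolynomial (Fin n) K))
    (L : Submodule K (ExteriorAlgebra K (Fin n → K))) :
    Submodule K (MvPolynomial (Fin n) K ⊗[K] ExteriorAlgebra K (Fin n → K)) :=
  Submodule.map₂ (TensorProduct.mk K _ _) (J.restrictScalars K) L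

variable {I J J' : Ideal (MvPolynomial (Fin n) K)}
  {L : Submodule K (ExteriorAlgebra K (Fin n → K))}

theorem tmul_mem_tensorSub {f : MvPolynomial (Fin n) K} {u : ExteriorAlgebra K (Fin n → K)}
    (hf : f ∈ J) (hu : u ∈ L) : f ⊗ₜ[K] u ∈ tensorSub J L :=
  Submodule.apply_mem_map₂ (TensorProduct.mk K _ _) hf hu

theorem tensorSub_le {U : Submodule K (MvPolynomial (Fin n) K ⊗[K] ExteriorAlgebra K (Fin n → K))} :
    tensorSub J L ≤ U ↔ ∀ f ∈ J, ∀ u ∈ L, f ⊗ₜ[K] u ∈ U :=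
  Submodule.map₂_le

theorem koszulTensor_mem {l : ℕ} {w : MvPolynomial (Fin n) K ⊗[K] ExteriorAlgebra K (Fin n → K)}
    (hw : w ∈ tensorSub J (⋀[K]^(l + 1) (Fin n → K))) :
    koszulTensor K w ∈ tensorSub J (⋀[K]^l (Fin n → K)) := by
  refine tensorSub_le (U := (tensorSub J _).comap (koszulTensor K)) |>.mpr (fun f hf u hu => ?_) hw
  rw [Submodule.mem_comap, koszulTensor_tmul]
  exact sum_mem fun i _ => tmul_mem_tensorSub (J.mul_mem_left _ hf) (contract_mem i hu)

theorem deRham_mem (a : Fin n → ℕ) (hJ : ∀ f ∈ J, ∀ i, pderiv i f ∈ J') {l : ℕ}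
    {w : MvPolynomial (Fin n) K ⊗[K] ExteriorAlgebra K (Fin n → K)}
    (hw : w ∈ tensorSub J (⋀[K]^l (Fin n → K))) :
    deRham K a w ∈ tensorSub J' (⋀[K]^(l + 1) (Fin n → K)) := by
  refine tensorSub_le (U := (tensorSub J' _).comap (deRham K a)) |>.mpr (fun f hf u hu => ?_) hw
  rw [Submodule.mem_comap, deRham_tmul]
  exact sum_mem fun i _ =>
    Submodule.smul_mem _ _ (tmul_mem_tensorSub (hJ f hf i) (wedge_mem i hu))

theorem lieEuler_mem (a : Fin n → ℕ) (hJ : ∀ f ∈ J, eulerDerivation K a f ∈ J) {l : ℕ}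
    {w : MvPolynomial (Fin n) K ⊗[K] ExteriorAlgebra K (Fin n → K)}
    (hw : w ∈ tensorSub J (⋀[K]^(l + 1) (Fin n → K))) :
    lieEuler K a w ∈ tensorSub J (⋀[K]^(l + 1) (Fin n → K)) := by
  refine tensorSub_le (U := (tensorSub J _).comap (lieEuler K a)) |>.mpr (fun f hf u hu => ?_) hw
  rw [Submodule.mem_comap, lieEuler_tmul]
  exact add_mem (tmul_mem_tensorSub (hJ f hf) hu) (tmul_mem_tensorSub hf (weightOp_mem a hu))

theorem mem_tensorSub_of_mem_of_mem
    {w : MvPolynomial (Fin n) K ⊗[K] ExteriorAlgebra K (Fin n → K)}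
    (hL : w ∈ tensorSub ⊤ L) (hJ : w ∈ tensorSub J ⊤) : w ∈ tensorSub J L := by
  obtain ⟨π, hπ⟩ := L.subtype.exists_leftInverse_of_injective L.ker_subtype
  let P := (L.subtype ∘ₗ π).lTensor (MvPolynomial (Fin n) K)
  have h : P w = w := by
    refine tensorSub_le (U := LinearMap.eqLocus P LinearMap.id) |>.mpr (fun f _ u hu => ?_) hL
    have e : π u = ⟨u, hu⟩ := LinearMap.congr_fun hπ ⟨u, hu⟩
    simp [P, LinearMap.mem_eqLocus, e]
  rw [← h]
  refine tensorSub_le (U := (tensorSub J L).comap P) |>.mpr (fun f hf u _ => ?_) hJ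
  exact tmul_mem_tensorSub hf (π u).2

theorem tensorSub_top_le_span_lieEuler_eigenvectors [CharZero K] (a : Fin n → ℕ)
    (ha : ∀ i, 0 < a i) (l : ℕ) :
    tensorSub ⊤ (⋀[K]^(l + 1) (Fin n → K)) ≤
      Submodule.span K {w | ∃ c : K, c ≠ 0 ∧ lieEuler K a w = c • w} := by
  refine tensorSub_le.mpr fun f _ u hu => ?_
  replace hu := exteriorPower_le_span_weightOp_eigenvectors a ha _ hu
  induction hu using Submodule.span_induction with
  | zero => simp
  | add u v _ _ hu hv => rw [TensorProduct.tmul_add]; exact add_mem hu hv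
  | smul r u _ hu => rw [TensorProduct.tmul_smul]; exact Submodule.smul_mem _ _ hu
  | mem u hu =>
    obtain ⟨c, hc, hu⟩ := hu
    induction f using MvPolynomial.induction_on' with
    | add p q hp hq =>
      rw [TensorProduct.add_tmul]
      exact add_mem (hp Submodule.mem_top) (hq Submodule.mem_top)
    | monomial s r =>
      have e : eulerDerivation K a (monomial s r) =
          ((Finsupp.weight a s : ℕ) : K) • monomial s r := by
        rw [Nat.cast_smul_eq_nsmul,
          ← (isWeightedHomogeneous_monomial a s r rfl).sum_weight_X_mul_pderiv,
          eulerDerivation_apply]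
        simp only [Nat.cast_smul_eq_nsmul]
      refine Submodule.subset_span ⟨(Finsupp.weight a s + c : ℕ), ?_, ?_⟩
      · exact Nat.cast_ne_zero.mpr (by omega)
      · rw [lieEuler_tmul, hu, e, ← TensorProduct.smul_tmul', TensorProduct.tmul_smul,
          Nat.cast_add, add_smul]

theorem exists_eq_add_koszulTensor [CharZero K] (a : Fin n → ℕ) (ha : ∀ i, 0 < a i)
    (hI : ∀ f ∈ I, ∀ d : ℕ, weightedHomogeneousComponent a d f ∈ I) (k l : ℕ)
    {w : MvPolynomial (Fin n) K ⊗[K] ExteriorAlgebra K (Fin n → K)}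
    (hw : w ∈ tensorSub ⊤ (⋀[K]^(l + 1) (Fin n → K)))
    (hdw : koszulTensor K w ∈ tensorSub (I ^ (k + 1)) ⊤) :
    ∃ z ∈ tensorSub (I ^ k) (⋀[K]^(l + 1) (Fin n → K)),
      ∃ b ∈ tensorSub ⊤ (⋀[K]^(l + 2) (Fin n → K)), w = z + koszulTensor K b := by
  obtain ⟨p, hp⟩ := exists_aeval_apply_eq_self (lieEuler K a)
    (tensorSub_top_le_span_lieEuler_eigenvectors a ha l hw)
  have hcomm : Commute (lieEuler K a) (koszulTensor K) := by
    have hsq : koszulTensor (n := n) K * koszulTensor K = 0 :=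
      LinearMap.ext koszulTensor_koszulTensor
    rw [commute_iff_eq, lieEuler, add_mul, mul_add, mul_assoc, hsq, mul_zero, zero_add,
      ← mul_assoc (koszulTensor K) (koszulTensor K), hsq, zero_mul, add_zero, mul_assoc]
  refine ⟨Polynomial.aeval (lieEuler K a) p (deRham K a (koszulTensor K w)), ?_,
    Polynomial.aeval (lieEuler K a) p (deRham K a w), ?_, ?_⟩
  · refine aeval_mem_of_mapsTo _ (fun v hv => lieEuler_mem a (fun f hf => ?_) hv) p
      (deRham_mem a (fun f hf i => derivation_mem_pow_of_mem_pow_succ _ hf)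
        (mem_tensorSub_of_mem_of_mem (koszulTensor_mem hw) hdw))
    exact derivation_mem_pow _ (fun f hf => eulerDerivation_mem a hI hf) hf
  · exact aeval_mem_of_mapsTo _ (fun v hv => lieEuler_mem a (fun _ _ => Submodule.mem_top) hv) p
      (deRham_mem a (fun _ _ _ => Submodule.mem_top) hw)
  · have h : Commute (Polynomial.aeval (lieEuler K a) p) (koszulTensor K) := by
      have hle : Algebra.adjoin K {lieEuler K a} ≤ Subalgebra.centralizer K {koszulTensor K} :=
        Algebra.adjoin_le (Set.singleton_subset_iff.mpr
          ((Subalgebra.mem_centralizer_iff K).mpr fun _ hT => by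
            rw [Set.mem_singleton_iff.mp hT, hcomm.eq]))
      exact ((Subalgebra.mem_centralizer_iff K).mp
        (hle (Polynomial.aeval_mem_adjoin_singleton K _)) _ rfl).symm
    rw [← Module.End.mul_apply (koszulTensor K), ← h.eq, Module.End.mul_apply, ← map_add,
      ← lieEuler_apply, hp]

end Homotopy

section BaseChange

variable (K : Type) [Field K] {n : ℕ} (R : Type) [CommRing R] [Algebra K R]

/-- The canonical map `⋀ Kⁿ → ⋀ Rⁿ`. -/
noncomputable def extMap :
    ExteriorAlgebra K (Fin n → K) →ₐ[K] ExteriorAlgebra R (Fin n → R) :=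
  ExteriorAlgebra.lift K
    ⟨(ExteriorAlgebra.ι R).restrictScalars K ∘ₗ (Algebra.linearMap K R).compLeft (Fin n),
      fun _ => ExteriorAlgebra.ι_sq_zero _⟩

/-- The canonical map `R ⊗ ⋀ Kⁿ → ⋀ Rⁿ`. -/
noncomputable def extBaseChange :
    R ⊗[K] ExteriorAlgebra K (Fin n → K) →ₐ[R] ExteriorAlgebra R (Fin n → R) :=
  Algebra.TensorProduct.lift (Algebra.ofId R _) (extMap K R) fun r u => by
    rw [Algebra.ofId_apply]
    exact Algebra.commutes (A := ExteriorAlgebra R (Fin n → R)) r _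

variable {K R}

theorem extMap_ι (v : Fin n → K) :
    extMap K R (ExteriorAlgebra.ι K v) = ExteriorAlgebra.ι R (fun i => algebraMap K R (v i)) :=
  ExteriorAlgebra.lift_ι_apply _ _ _ _

theorem extBaseChange_tmul (r : R) (u : ExteriorAlgebra K (Fin n → K)) :
    extBaseChange K R (r ⊗ₜ u) = r • extMap K R u := by
  rw [extBaseChange, Algebra.TensorProduct.lift_tmul, Algebra.smul_def]
  rfl

theorem extBaseChange_injective [CharZero K] :
    Function.Injective (extBaseChange (n := n) K R) := by
  let g : (Fin n → R) →ₗ[R] R ⊗[K] ExteriorAlgebra K (Fin n → K) :=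
    Fintype.linearCombination R fun i => 1 ⊗ₜ ExteriorAlgebra.ι K (Pi.single i 1)
  have hg (v : Fin n → R) : g v * g v = 0 := by
    simp only [g, Fintype.linearCombination_apply, Finset.sum_mul_sum]
    refine sum_sum_eq_zero_of_antisymm (K := K) _ fun i j => ?_
    simp only [smul_mul_smul_comm, Algebra.TensorProduct.tmul_mul_tmul]
    rw [mul_comm (v i), eq_neg_of_add_eq_zero_left (ExteriorAlgebra.ι_add_mul_swap _ _),
      TensorProduct.tmul_neg, smul_neg]
  let ψ := ExteriorAlgebra.lift R ⟨g, hg⟩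
  have h₁ : (ψ.restrictScalars K).comp (extMap K R) = Algebra.TensorProduct.includeRight := by
    ext i
    have h : (fun j => algebraMap K R ((Pi.single i 1 : Fin n → K) j)) = Pi.single i 1 := by
      ext j
      by_cases h : i = j <;> simp [h, eq_comm]
    simp only [LinearMap.comp_apply, LinearMap.single_apply, AlgHom.toLinearMap_apply,
      AlgHom.comp_apply, AlgHom.restrictScalars_apply, extMap_ι, h,
      Algebra.TensorProduct.includeRight_apply]
    exact (ExteriorAlgebra.lift_ι_apply R g hg _).trans
      ((Fintype.linearCombination_apply_single R _ i 1).trans (one_smul _ _))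
  refine Function.LeftInverse.injective (g := ψ) fun t => ?_
  induction t with
  | zero => simp
  | add x y hx hy => rw [map_add, map_add, hx, hy]
  | tmul r u =>
    rw [extBaseChange_tmul, map_smul]
    have := DFunLike.congr_fun h₁ u
    refine (congrArg (r • ·) this).trans ?_
    simp [TensorProduct.smul_tmul']

theorem extMap_mem {l : ℕ} {u : ExteriorAlgebra K (Fin n → K)}
    (hu : u ∈ ⋀[K]^l (Fin n → K)) : extMap K R u ∈ ⋀[R]^l (Fin n → R) := by
  induction l generalizing u with
  | zero =>
    rw [ExteriorAlgebra.exteriorPower, pow_zero] at hu ⊢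
    obtain ⟨r, rfl⟩ := Submodule.mem_one.mp hu
    rw [AlgHom.commutes, IsScalarTower.algebraMap_apply K R]
    exact Submodule.mem_one.mpr ⟨_, rfl⟩
  | succ l ih =>
    rw [ExteriorAlgebra.exteriorPower, pow_succ'] at hu ⊢
    refine Submodule.mul_induction_on hu ?_ fun x y hx hy => by
      rw [map_add]; exact add_mem hx hy
    rintro _ ⟨v, rfl⟩ y hy
    rw [map_mul, extMap_ι]
    exact Submodule.mul_mem_mul (LinearMap.mem_range_self _ _) (ih hy)

theorem exteriorPower_le_span_extMap (l : ℕ) :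
    ⋀[R]^l (Fin n → R) ≤ Submodule.span R (extMap K R '' ⋀[K]^l (Fin n → K)) := by
  induction l with
  | zero =>
    intro u hu
    rw [ExteriorAlgebra.exteriorPower, pow_zero] at hu
    obtain ⟨r, rfl⟩ := Submodule.mem_one.mp hu
    rw [Algebra.algebraMap_eq_smul_one]
    refine Submodule.smul_mem _ _ (Submodule.subset_span ⟨1, ?_, map_one _⟩)
    rw [ExteriorAlgebra.exteriorPower, pow_zero]
    exact Submodule.one_le.mp le_rfl
  | succ l ih =>
    rw [ExteriorAlgebra.exteriorPower, pow_succ', Submodule.mul_le]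
    rintro _ ⟨v, rfl⟩ y hy
    replace hy := ih hy
    induction hy using Submodule.span_induction with
    | zero => simp
    | add x y _ _ hx hy => rw [mul_add]; exact add_mem hx hy
    | smul r x _ hx => rw [mul_smul_comm]; exact Submodule.smul_mem _ _ hx
    | mem x hx =>
      obtain ⟨u, hu, rfl⟩ := hx
      rw [pi_eq_sum_univ' v, map_sum, Finset.sum_mul]
      refine sum_mem fun j _ => ?_
      rw [map_smul, smul_mul_assoc]
      refine Submodule.smul_mem _ _ (Submodule.subset_span ⟨wedge K j u, wedge_mem j hu, ?_⟩)
      rw [wedge, LinearMap.mulLeft_apply, map_mul, extMap_ι]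
      congr 2
      ext i
      by_cases h : j = i <;> simp [h, eq_comm]

theorem koszulDiff_algebraMap (x : Fin n → R) (r : R) :
    koszulDiff R x (algebraMap R _ r) = 0 :=
  CliffordAlgebra.contractLeft_algebraMap _ _ r

theorem koszulDiff_ι_mul (x v : Fin n → R) (u : ExteriorAlgebra R (Fin n → R)) :
    koszulDiff R x (ExteriorAlgebra.ι R v * u) =
      (∑ i, x i * v i) • u - ExteriorAlgebra.ι R v * koszulDiff R x u := by
  refine (CliffordAlgebra.contractLeft_ι_mul _ _ _).trans ?_
  simp [koszulDiff, ExteriorAlgebra.ι]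

theorem koszulDiff_extMap (x : Fin n → R) (u : ExteriorAlgebra K (Fin n → K)) :
    koszulDiff R x (extMap K R u) = ∑ i, x i • extMap K R (contract K i u) := by
  induction u using CliffordAlgebra.left_induction with
  | algebraMap r =>
    refine Eq.trans ?_ (Finset.sum_eq_zero fun i _ => ?_).symm
    · refine (congrArg _ ((extMap K R).commutes r)).trans ?_
      rw [IsScalarTower.algebraMap_apply K R]
      exact koszulDiff_algebraMap _ _
    · refine (congrArg (fun y => x i • extMap K R y) (contract_algebraMap i r)).trans ?_
      rw [map_zero, smul_zero]
  | add u v hu hv =>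
    rw [map_add, map_add, hu, hv, ← Finset.sum_add_distrib]
    simp only [map_add, smul_add]
  | ι_mul u v hu =>
    have h : extMap K R (ExteriorAlgebra.ι K v * u) =
        ExteriorAlgebra.ι R (fun i => algebraMap K R (v i)) * extMap K R u := by
      rw [map_mul, extMap_ι]
    refine (congrArg _ h).trans ?_
    rw [koszulDiff_ι_mul, hu, Finset.sum_smul, Finset.mul_sum, ← Finset.sum_sub_distrib]
    refine Finset.sum_congr rfl fun i _ => ?_
    refine Eq.trans ?_ (congrArg (fun y => x i • extMap K R y) (contract_ι_mul i v u)).symm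
    rw [map_sub, map_smul, map_mul, extMap_ι, smul_sub, mul_smul_comm, mul_smul,
      algebraMap_smul]

theorem koszulDiff_extBaseChange_tmul (x : Fin n → R) (r : R)
    (u : ExteriorAlgebra K (Fin n → K)) :
    koszulDiff R x (extBaseChange K R (r ⊗ₜ u)) =
      ∑ i, extBaseChange K R ((x i * r) ⊗ₜ contract K i u) := by
  rw [extBaseChange_tmul, map_smul, koszulDiff_extMap, Finset.smul_sum]
  refine Finset.sum_congr rfl fun i _ => ?_
  rw [extBaseChange_tmul, smul_smul, mul_comm]

theorem extBaseChange_mem_smul (𝔞 : Ideal R) {l : ℕ} {t : R ⊗[K] ExteriorAlgebra K (Fin n → K)}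
    (ht : t ∈ Submodule.map₂ (TensorProduct.mk K R _) (𝔞.restrictScalars K)
      (⋀[K]^l (Fin n → K))) :
    extBaseChange K R t ∈ 𝔞 • ⋀[R]^l (Fin n → R) := by
  rw [Submodule.map₂_eq_span_image2] at ht
  induction ht using Submodule.span_induction with
  | zero => simp
  | add x y _ _ hx hy => rw [map_add]; exact add_mem hx hy
  | smul c x _ hx =>
    rw [← algebraMap_smul R c x, map_smul]
    exact Submodule.smul_mem _ _ hx
  | mem x hx =>
    obtain ⟨r, hr, u, hu, rfl⟩ := hx
    refine (extBaseChange_tmul r u).symm ▸ ?_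
    exact Submodule.smul_mem_smul hr (extMap_mem hu)

end BaseChange

section Reduction

variable {K : Type} [Field K] {n : ℕ} {I J : Ideal (MvPolynomial (Fin n) K)}

/-- The canonical map from `S ⊗ ⋀ Kⁿ` to the Koszul complex of `S / J`. -/
noncomputable def reduction (J : Ideal (MvPolynomial (Fin n) K)) :
    MvPolynomial (Fin n) K ⊗[K] ExteriorAlgebra K (Fin n → K) →ₗ[K]
      ExteriorAlgebra (MvPolynomial (Fin n) K ⧸ J) (Fin n → MvPolynomial (Fin n) K ⧸ J) :=
  (extBaseChange K (MvPolynomial (Fin n) K ⧸ J)).toLinearMap.restrictScalars K ∘ₗ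
    (Ideal.Quotient.mkₐ K J).toLinearMap.rTensor _

theorem reduction_tmul (f : MvPolynomial (Fin n) K) (u : ExteriorAlgebra K (Fin n → K)) :
    reduction J (f ⊗ₜ u) = Ideal.Quotient.mk J f • extMap K _ u :=
  extBaseChange_tmul _ _

theorem koszulDiff_reduction
    (w : MvPolynomial (Fin n) K ⊗[K] ExteriorAlgebra K (Fin n → K)) :
    koszulDiff _ (fun i => Ideal.Quotient.mk J (X i)) (reduction J w) =
      reduction J (koszulTensor K w) := by
  induction w with
  | zero => simp
  | add x y hx hy => simp only [map_add, hx, hy]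
  | tmul f u =>
    rw [koszulTensor_tmul, map_sum]
    refine (koszulDiff_extBaseChange_tmul _ _ _).trans (Finset.sum_congr rfl fun i _ => ?_)
    rw [AlgHom.toLinearMap_apply, Ideal.Quotient.mkₐ_eq_mk, ← map_mul]
    rfl

theorem mem_tensorSub_of_reduction_eq_zero [CharZero K]
    {w : MvPolynomial (Fin n) K ⊗[K] ExteriorAlgebra K (Fin n → K)} (hw : reduction J w = 0) :
    w ∈ tensorSub J ⊤ := by
  have h : (Ideal.Quotient.mkₐ K J).toLinearMap.rTensor
      (ExteriorAlgebra K (Fin n → K)) w = 0 :=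
    extBaseChange_injective (hw.trans (map_zero _).symm)
  have hex : Function.Exact (J.restrictScalars K).subtype
      (Ideal.Quotient.mkₐ K J).toLinearMap := fun f => by
    simp [Ideal.Quotient.eq_zero_iff_mem]
  obtain ⟨t, rfl⟩ := (rTensor_exact _ hex (Ideal.Quotient.mkₐ_surjective K J) w).mp h
  clear hw h
  induction t with
  | zero => simp
  | add x y hx hy => rw [map_add]; exact add_mem hx hy
  | tmul f u => exact tmul_mem_tensorSub f.2 Submodule.mem_top

theorem exists_reduction_eq {l : ℕ}
    {z : ExteriorAlgebra (MvPolynomial (Fin n) K ⧸ J) (Fin n → MvPolynomial (Fin n) K ⧸ J)}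
    (hz : z ∈ ⋀[MvPolynomial (Fin n) K ⧸ J]^l (Fin n → MvPolynomial (Fin n) K ⧸ J)) :
    ∃ w ∈ tensorSub ⊤ (⋀[K]^l (Fin n → K)), reduction J w = z := by
  replace hz := exteriorPower_le_span_extMap (K := K) l hz
  induction hz using Submodule.closure_induction with
  | zero => exact ⟨0, zero_mem _, map_zero _⟩
  | add x y _ _ hx hy =>
    obtain ⟨v, hv, rfl⟩ := hx
    obtain ⟨w, hw, rfl⟩ := hy
    exact ⟨v + w, add_mem hv hw, map_add _ _ _⟩
  | smul_mem r x hx =>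
    obtain ⟨u, hu, rfl⟩ := hx
    obtain ⟨f, rfl⟩ := Ideal.Quotient.mk_surjective r
    exact ⟨f ⊗ₜ u, tmul_mem_tensorSub Submodule.mem_top hu, reduction_tmul _ _⟩

theorem reduction_mem_smul {l : ℕ}
    {w : MvPolynomial (Fin n) K ⊗[K] ExteriorAlgebra K (Fin n → K)}
    (hw : w ∈ tensorSub I (⋀[K]^l (Fin n → K))) :
    reduction J w ∈ I.map (Ideal.Quotient.mk J) •
      ⋀[MvPolynomial (Fin n) K ⧸ J]^l (Fin n → MvPolynomial (Fin n) K ⧸ J) := by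
  refine extBaseChange_mem_smul _ ?_
  refine tensorSub_le (U := (Submodule.map₂ (TensorProduct.mk K _ _)
    ((I.map (Ideal.Quotient.mk J)).restrictScalars K) _).comap
      ((Ideal.Quotient.mkₐ K J).toLinearMap.rTensor _)) |>.mpr (fun f hf u hu => ?_) hw
  exact Submodule.apply_mem_map₂ _ (Ideal.mem_map_of_mem _ hf) hu

end Reduction

end KoszulPower

/-- Let `K` be a field of characteristic `0`, `S = K[x_1, …, x_n]` a positively graded
polynomial ring with `deg x_i = a_i > 0`, `I ⊂ S` a proper graded ideal, `k ≥ 1` an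
integer, and set `R = S/I^k`.  Then for every `l ≥ 1`, every homology class in
`H_l(x; R)` can be represented by a cycle `z' ∈ Z_l(R)` lying in `I^{k-1}·K_l(R)`,
i.e. for every cycle `z ∈ Z_l(R)` there is a cycle `z' ∈ Z_l(R)` all of whose
coefficients lie in the image of `I^{k-1}` in `R` and which is homologous to `z`
(`z - z'` is a boundary). -/
theorem powers_koszul_class_represented_in_power
    (K : Type) [Field K] [CharZero K] (n : ℕ)
    (a : Fin n → ℕ) (ha : ∀ i, 0 < a i)
    (I : Ideal (MvPolynomial (Fin n) K)) (hI : I ≠ ⊤)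
    (hIhom : ∀ f ∈ I, ∀ d : ℕ, MvPolynomial.weightedHomogeneousComponent a d f ∈ I)
    (k : ℕ) (hk : 1 ≤ k) (l : ℕ) (hl : 1 ≤ l)
    (z : ExteriorAlgebra (MvPolynomial (Fin n) K ⧸ I ^ k)
      (Fin n → MvPolynomial (Fin n) K ⧸ I ^ k))
    (hz : z ∈ koszulCycles (MvPolynomial (Fin n) K ⧸ I ^ k)
      (fun i => Ideal.Quotient.mk (I ^ k) (MvPolynomial.X i)) l) :
    ∃ z', z' ∈ koszulCycles (MvPolynomial (Fin n) K ⧸ I ^ k)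
        (fun i => Ideal.Quotient.mk (I ^ k) (MvPolynomial.X i)) l ∧
      z' ∈ (I ^ (k - 1)).map (Ideal.Quotient.mk (I ^ k)) •
        ⋀[MvPolynomial (Fin n) K ⧸ I ^ k]^l (Fin n → MvPolynomial (Fin n) K ⧸ I ^ k) ∧
      z - z' ∈ koszulBoundaries (MvPolynomial (Fin n) K ⧸ I ^ k)
        (fun i => Ideal.Quotient.mk (I ^ k) (MvPolynomial.X i)) l := by
  obtain ⟨k, rfl⟩ := Nat.exists_eq_add_of_le' hk
  obtain ⟨l, rfl⟩ := Nat.exists_eq_add_of_le' hl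
  obtain ⟨hzl, hz⟩ := hz
  obtain ⟨w, hw, rfl⟩ := KoszulPower.exists_reduction_eq hzl
  replace hz := (KoszulPower.koszulDiff_reduction w).symm.trans (LinearMap.mem_ker.mp hz)
  obtain ⟨z, hzI, b, hb, hwz⟩ := KoszulPower.exists_eq_add_koszulTensor a ha hIhom k l hw
    (KoszulPower.mem_tensorSub_of_reduction_eq_zero hz)
  have hzI' := KoszulPower.reduction_mem_smul (J := I ^ (k + 1)) hzI
  have hb' : KoszulPower.reduction (I ^ (k + 1)) b ∈
      ⋀[MvPolynomial (Fin n) K ⧸ I ^ (k + 1)]^(l + 1 + 1)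
        (Fin n → MvPolynomial (Fin n) K ⧸ I ^ (k + 1)) :=
    Submodule.smul_le_right (KoszulPower.reduction_mem_smul hb)
  refine ⟨KoszulPower.reduction (I ^ (k + 1)) z, ⟨Submodule.smul_le_right hzI', ?_⟩, hzI',
    KoszulPower.reduction (I ^ (k + 1)) b, hb', ?_⟩
  · refine LinearMap.mem_ker.mpr ((KoszulPower.koszulDiff_reduction z).trans (Eq.trans ?_ hz))
    rw [hwz, map_add, KoszulPower.koszulTensor_koszulTensor, add_zero]
  · rw [KoszulPower.koszulDiff_reduction, hwz, map_add, add_sub_cancel_left]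
end
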